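/- arXiv:2603.19509 — 9 statements merged into one kernel-verified Lean document; each statement's English description precedes it below -/
import Mathlib

section
/- Let B be a normed real vector space, let ℓ : B → ℝ be a linear functional, and let V := ker ℓ. Let (L_n)_{n∈ℤ} be a family of linear maps L_n : B → B satisfying ℓ(L_n v) = ℓ(v) for all v ∈ B and all n. Assume the family has strong loss of memory on V: there is a sequence a : ℕ → ℝ with a(k) → 0 as k → ∞ such that for every j ∈ ℤ, every k ≥ 1 and every v ∈ V one has ‖L_{j+k−1} ∘ ⋯ ∘ L_j v‖ ≤ a(k)‖v‖. Then there is at most one bounded equivariant family of unit mass: if (μ_n)_{n∈ℤ} and (ν_n)_{n∈ℤ} satisfy μ_{n+1} = L_n μ_n and ν_{n+1} = L_n ν_n for all n, with ℓ(μ_n) = ℓ(ν_n) = 1 for all n, and sup_{n∈ℤ} ‖μ_n‖ < ∞ and sup_{n∈ℤ} ‖ν_n‖ < ∞, then μ_n = ν_n for all n ∈ ℤ. -/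
open Filter

/-- `seqComp L j k = L (j+k−1) ∘ ⋯ ∘ L j` : the sequential composition of `k` operators
of the family `L`, starting with `L j` (applied first). `seqComp L j 0` is the identity. -/
noncomputable def seqComp {B : Type*} [NormedAddCommGroup B] [NormedSpace ℝ B]
    (L : ℤ → (B →ₗ[ℝ] B)) (j : ℤ) : ℕ → (B →ₗ[ℝ] B)
  | 0 => LinearMap.id
  | (k + 1) => L (j + (k : ℤ)) ∘ₗ seqComp L j k

/-- Iterating the operators transports an equivariant family along itself. -/
theorem seqComp_apply_equivariant {B : Type*} [NormedAddCommGroup B] [NormedSpace ℝ B]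
    (L : ℤ → (B →ₗ[ℝ] B)) (μ : ℤ → B) (hμ : ∀ n : ℤ, μ (n + 1) = L n (μ n)) (j : ℤ) (k : ℕ) :
    seqComp L j k (μ j) = μ (j + k) := by
  induction k with
  | zero => simp [seqComp]
  | succ k ih =>
    rw [seqComp, LinearMap.comp_apply, ih, ← hμ]
    push_cast
    rw [add_assoc]

/-- If a family of mass-preserving linear operators `(L_n)_{n ∈ ℤ}` on a normed space has
strong loss of memory on the zero-mass subspace `V = ker ℓ`, then there is at most one
bounded equivariant family of unit mass. -/
theorem uniqueness_of_bounded_equivariant_family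
    {B : Type*} [NormedAddCommGroup B] [NormedSpace ℝ B]
    (ℓ : B →ₗ[ℝ] ℝ) (L : ℤ → (B →ₗ[ℝ] B))
    (hmass : ∀ (n : ℤ) (v : B), ℓ (L n v) = ℓ v)
    (a : ℕ → ℝ) (ha : Tendsto a atTop (nhds 0))
    (hlom : ∀ (j : ℤ) (k : ℕ), 1 ≤ k → ∀ v ∈ LinearMap.ker ℓ,
      ‖(seqComp L j k) v‖ ≤ a k * ‖v‖)
    (μ ν : ℤ → B)
    (hμeq : ∀ n : ℤ, μ (n + 1) = L n (μ n))
    (hνeq : ∀ n : ℤ, ν (n + 1) = L n (ν n))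
    (hμmass : ∀ n : ℤ, ℓ (μ n) = 1)
    (hνmass : ∀ n : ℤ, ℓ (ν n) = 1)
    (hμbd : ∃ M : ℝ, ∀ n : ℤ, ‖μ n‖ ≤ M)
    (hνbd : ∃ M : ℝ, ∀ n : ℤ, ‖ν n‖ ≤ M) :
    ∀ n : ℤ, μ n = ν n := by
  obtain ⟨M, hM⟩ := hμbd
  obtain ⟨N, hN⟩ := hνbd
  intro n
  have hbound : ∀ k : ℕ, 1 ≤ k → ‖μ n - ν n‖ ≤ |a k| * (M + N) := by
    intro k hk
    have hker : μ (n - k) - ν (n - k) ∈ LinearMap.ker ℓ := by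
      simp [hμmass, hνmass]
    have h := hlom (n - k) k hk _ hker
    rw [map_sub, seqComp_apply_equivariant L μ hμeq, seqComp_apply_equivariant L ν hνeq,
      sub_add_cancel] at h
    calc ‖μ n - ν n‖ ≤ a k * ‖μ (n - k) - ν (n - k)‖ := h
      _ ≤ |a k| * ‖μ (n - k) - ν (n - k)‖ := by gcongr; exact le_abs_self _
      _ ≤ |a k| * (M + N) := by
        gcongr
        exact (norm_sub_le _ _).trans (add_le_add (hM _) (hN _))
  have hlim : Tendsto (fun k => |a k| * (M + N)) atTop (nhds 0) := by
    simpa using ha.abs.mul_const (M + N)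
  have hle : ‖μ n - ν n‖ ≤ 0 :=
    ge_of_tendsto hlim ((eventually_ge_atTop 1).mono hbound)
  exact sub_eq_zero.mp (norm_le_zero_iff.mp hle)
end

section
/- Let V be a real vector space equipped with two norms ‖·‖_s and ‖·‖_w with ‖v‖_w ≤ C_sw ‖v‖_s for all v ∈ V, where (V, ‖·‖_s) is complete. Let C ≥ 1, ρ ∈ (0,1), M_w ≥ 1 and let T₀, T₁ : V → V be linear maps such that: (A1) ‖T_⋆^k v‖_s ≤ C ρ^k ‖v‖_s for ⋆ ∈ {0,1}, all k ≥ 1 and all v ∈ V; (A2) ‖T_⋆^k v‖_w ≤ M_w ‖v‖_w for ⋆ ∈ {0,1}, all k ≥ 0 and all v ∈ V; (A3) there is δ ∈ (0,1) with ‖(T₁ − T₀)v‖_w ≤ δ ‖v‖_s for all v ∈ V. Then for ⋆ ∈ {0,1} the operator I − T_⋆ is invertible on (V, ‖·‖_s) with (I − T_⋆)^{−1} = Σ_{k=0}^∞ T_⋆^k (convergent in operator norm with respect to ‖·‖_s), and there exists a constant K, depending only on C, ρ, M_w, C_sw, such that for all v ∈ V, ‖((I − T₁)^{−1} − (I − T₀)^{−1})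 v‖_w ≤ K δ (1 + log(1/δ)) ‖v‖_s. -/
/-- A bounded operator with `‖T ^ k v‖ ≤ C ρ ^ k ‖v‖` for `k ≥ 1` has a Neumann-series
inverse of `1 - T`, of norm at most `C (1 - ρ)⁻¹`. -/
theorem exists_neumann_inverse_of_norm_pow_le
    {V : Type*} [NormedAddCommGroup V] [NormedSpace ℝ V] [CompleteSpace V]
    {C ρ : ℝ} (hC : 1 ≤ C) (hρ : ρ ∈ Set.Ioo (0 : ℝ) 1) (T : V →L[ℝ] V)
    (hT : ∀ k : ℕ, 1 ≤ k → ∀ v : V, ‖(T ^ k) v‖ ≤ C * ρ ^ k * ‖v‖) :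
    ∃ R : V →L[ℝ] V, (1 - T) * R = 1 ∧ R * (1 - T) = 1 ∧
      HasSum (fun k : ℕ => T ^ k) R ∧ ∀ v, ‖R v‖ ≤ C * (1 - ρ)⁻¹ * ‖v‖ := by
  have hC0 : 0 ≤ C := zero_le_one.trans hC
  have hρ0 : 0 ≤ ρ := hρ.1.le
  have hpow : ∀ k : ℕ, ‖T ^ k‖ ≤ C * ρ ^ k := by
    intro k
    refine ContinuousLinearMap.opNorm_le_bound _ (by positivity) fun v => ?_
    rcases Nat.eq_zero_or_pos k with rfl | hk
    · simpa using le_mul_of_one_le_left (norm_nonneg v) hC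
    · exact hT k hk v
  have hgeom : HasSum (fun k : ℕ => C * ρ ^ k) (C * (1 - ρ)⁻¹) :=
    (hasSum_geometric_of_lt_one hρ0 hρ.2).mul_left C
  have hsum : Summable (fun k : ℕ => T ^ k) := .of_norm_bounded hgeom.summable hpow
  refine ⟨∑' k : ℕ, T ^ k, hsum.one_sub_mul_tsum_pow, hsum.tsum_pow_mul_one_sub,
    hsum.hasSum, fun v => ?_⟩
  exact ContinuousLinearMap.le_of_opNorm_le _ (tsum_of_norm_bounded hgeom hpow) v

/-- A subadditive function grows at most linearly along partial sums of a power-bounded orbit. -/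
theorem apply_geom_sum_le_of_subadditive
    {V : Type*} [NormedAddCommGroup V] [NormedSpace ℝ V]
    {nw : V → ℝ} (hzero : nw 0 = 0) (hadd : ∀ u v, nw (u + v) ≤ nw u + nw v)
    {M : ℝ} {T : V →L[ℝ] V} (hT : ∀ k : ℕ, ∀ v : V, nw ((T ^ k) v) ≤ M * nw v)
    (n : ℕ) (v : V) :
    nw ((∑ k ∈ Finset.range n, T ^ k) v) ≤ n * (M * nw v) := by
  induction n with
  | zero => simp [hzero]
  | succ n ih =>
    rw [Finset.sum_range_succ, add_apply, Nat.cast_succ]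
    linarith [hadd ((∑ k ∈ Finset.range n, T ^ k) v) ((T ^ n) v), hT n v]

/-- For `ρ, δ ∈ (0, 1)`, some `n ≥ 1` of size `O(1 + log (1 / δ))` satisfies `ρ ^ n ≤ δ`. -/
theorem exists_nat_pow_le_of_log {ρ δ : ℝ} (hρ : ρ ∈ Set.Ioo (0 : ℝ) 1)
    (hδ : δ ∈ Set.Ioo (0 : ℝ) 1) :
    ∃ n : ℕ, 1 ≤ n ∧ ρ ^ n ≤ δ ∧
      (n : ℝ) ≤ (2 + (Real.log (1 / ρ))⁻¹) * (1 + Real.log (1 / δ)) := by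
  have hlρ : 0 < Real.log (1 / ρ) := Real.log_pos (one_lt_one_div hρ.1 hρ.2)
  have hlδ : 0 < Real.log (1 / δ) := Real.log_pos (one_lt_one_div hδ.1 hδ.2)
  set a := Real.log (1 / ρ) with ha
  set L := Real.log (1 / δ) with hL
  have hq : 0 ≤ L / a := by positivity
  refine ⟨⌈L / a⌉₊ + 1, by omega, ?_, ?_⟩
  · have h1 : L ≤ (⌈L / a⌉₊ + 1 : ℕ) * a := by
      rw [← div_le_iff₀ hlρ]
      push_cast
      linarith [Nat.le_ceil (L / a)]
    rw [← Real.log_le_log_iff (pow_pos hρ.1 _) hδ.1, Real.log_pow]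
    simp only [ha, hL, one_div, Real.log_inv] at h1 ⊢
    linarith
  · have h2 := (Nat.ceil_lt_add_one hq).le
    have h3 : 0 < a⁻¹ := inv_pos.2 hlρ
    rw [div_eq_mul_inv] at h2
    push_cast
    rw [div_eq_mul_inv]
    nlinarith

/-- `ε log ε`-continuity of the resolvent in the mixed (strong→weak) norm.
`V` carries a strong norm `‖·‖` (in which it is complete) and a weak norm `nw` with
`nw ≤ C_sw ‖·‖`. If `T₀, T₁` satisfy strong exponential memory loss (A1), weak power
boundedness (A2) and mixed closeness `‖T₁ − T₀‖_{s→w} ≤ δ` (A3), then `I − T_⋆` is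
invertible with Neumann-series inverse, and the two resolvents differ in the mixed norm
by at most `K δ (1 + log(1/δ))`, with `K` depending only on `C, ρ, M_w, C_sw`. -/
theorem resolvent_mixed_norm_continuity
    {V : Type*} [NormedAddCommGroup V] [NormedSpace ℝ V] [CompleteSpace V]
    (nw : V → ℝ)
    (hnw_nonneg : ∀ v, 0 ≤ nw v)
    (hnw_add : ∀ u v, nw (u + v) ≤ nw u + nw v)
    (hnw_smul : ∀ (c : ℝ) (v : V), nw (c • v) = |c| * nw v)
    (hnw_def : ∀ v, nw v = 0 → v = 0)
    (C_sw : ℝ) (hsw : ∀ v, nw v ≤ C_sw * ‖v‖)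
    (C ρ M_w : ℝ) (hC : 1 ≤ C) (hρ : ρ ∈ Set.Ioo (0 : ℝ) 1) (hMw : 1 ≤ M_w) :
    ∃ K : ℝ, ∀ (T₀ T₁ : V →L[ℝ] V) (δ : ℝ),
      (∀ k : ℕ, 1 ≤ k → ∀ v : V, ‖(T₀ ^ k) v‖ ≤ C * ρ ^ k * ‖v‖) →
      (∀ k : ℕ, 1 ≤ k → ∀ v : V, ‖(T₁ ^ k) v‖ ≤ C * ρ ^ k * ‖v‖) →
      (∀ k : ℕ, ∀ v : V, nw ((T₀ ^ k) v) ≤ M_w * nw v) →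
      (∀ k : ℕ, ∀ v : V, nw ((T₁ ^ k) v) ≤ M_w * nw v) →
      δ ∈ Set.Ioo (0 : ℝ) 1 →
      (∀ v : V, nw (T₁ v - T₀ v) ≤ δ * ‖v‖) →
      ∃ R₀ R₁ : V →L[ℝ] V,
        ((1 - T₀) * R₀ = 1 ∧ R₀ * (1 - T₀) = 1 ∧ HasSum (fun k : ℕ => T₀ ^ k) R₀) ∧
        ((1 - T₁) * R₁ = 1 ∧ R₁ * (1 - T₁) = 1 ∧ HasSum (fun k : ℕ => T₁ ^ k) R₁) ∧
        ∀ v : V, nw (R₁ v - R₀ v) ≤ K * δ * (1 + Real.log (1 / δ)) * ‖v‖ := by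
  have hzero : nw 0 = 0 := by simpa using hnw_smul 0 0
  have hC0 : 0 ≤ C := zero_le_one.trans hC
  have hM0 : 0 ≤ M_w := zero_le_one.trans hMw
  have hρ1 : 0 < 1 - ρ := sub_pos.2 hρ.2
  set A : ℝ := C * (1 - ρ)⁻¹ with hA
  have hA0 : 0 ≤ A := by positivity
  have hlρ : 0 < Real.log (1 / ρ) := Real.log_pos (one_lt_one_div hρ.1 hρ.2)
  set B : ℝ := 2 + (Real.log (1 / ρ))⁻¹ with hB
  set D : ℝ := |C_sw| * C * A * (2 * C * ρ) with hD
  have hD0 : 0 ≤ D := by have := hρ.1; positivity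
  refine ⟨(B * M_w + D) * A, fun T₀ T₁ δ hs₀ hs₁ _ hw₁ hδ hclose => ?_⟩
  obtain ⟨R₀, hl₀, hr₀, hsum₀, hR₀⟩ := exists_neumann_inverse_of_norm_pow_le hC hρ T₀ hs₀
  obtain ⟨R₁, hl₁, hr₁, hsum₁, hR₁⟩ := exists_neumann_inverse_of_norm_pow_le hC hρ T₁ hs₁
  refine ⟨R₀, R₁, ⟨hl₀, hr₀, hsum₀⟩, ⟨hl₁, hr₁, hsum₁⟩, fun v => ?_⟩
  obtain ⟨n, hn, hρn, hnB⟩ := exists_nat_pow_le_of_log hρ hδ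
  have hlδ : 0 < Real.log (1 / δ) := Real.log_pos (one_lt_one_div hδ.1 hδ.2)
  set L := Real.log (1 / δ)
  set u := R₀ v with hu
  set d := T₁ u - T₀ u with hd
  have hresolvent : R₁ - R₀ = R₁ * (T₁ - T₀) * R₀ := by
    calc R₁ - R₀ = R₁ * ((1 - T₀) * R₀) - R₁ * (1 - T₁) * R₀ := by rw [hl₀, hr₁]; simp
      _ = R₁ * (T₁ - T₀) * R₀ := by noncomm_ring
  have hsplit : R₁ = ∑ k ∈ Finset.range n, T₁ ^ k + T₁ ^ n * R₁ := by
    have h : (∑ k ∈ Finset.range n, T₁ ^ k) * ((1 - T₁) * R₁) = (1 - T₁ ^ n) * R₁ := by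
      rw [← mul_assoc, geom_sum_mul_neg]
    rw [hl₁, mul_one] at h
    rw [h]
    noncomm_ring
  have hdiff : R₁ v - R₀ v = (∑ k ∈ Finset.range n, T₁ ^ k) d + (T₁ ^ n) (R₁ d) := by
    have h1 : R₁ v - R₀ v = R₁ d := by
      simpa [hd, hu] using DFunLike.congr_fun hresolvent v
    have h2 := DFunLike.congr_fun hsplit d
    rw [h1]
    exact h2
  have hu_le : ‖u‖ ≤ A * ‖v‖ := hR₀ v
  have hd_norm : ‖d‖ ≤ 2 * C * ρ * ‖u‖ := by
    have h0 := hs₀ 1 le_rfl u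
    have h1 := hs₁ 1 le_rfl u
    simp only [pow_one] at h0 h1
    linarith [norm_sub_le (T₁ u) (T₀ u)]
  have hhead : nw ((∑ k ∈ Finset.range n, T₁ ^ k) d) ≤ B * (1 + L) * (M_w * (δ * ‖u‖)) := by
    refine (apply_geom_sum_le_of_subadditive hzero hnw_add hw₁ n d).trans ?_
    have := hnw_nonneg d
    have := hclose u
    gcongr
  have htail : nw ((T₁ ^ n) (R₁ d)) ≤ D * (δ * ‖u‖) := by
    have hρ0 := hρ.1
    have hδ0 := hδ.1
    calc nw ((T₁ ^ n) (R₁ d)) ≤ C_sw * ‖(T₁ ^ n) (R₁ d)‖ := hsw _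
      _ ≤ |C_sw| * ‖(T₁ ^ n) (R₁ d)‖ := by gcongr; exact le_abs_self _
      _ ≤ |C_sw| * (C * ρ ^ n * ‖R₁ d‖) := by gcongr; exact hs₁ n hn _
      _ ≤ |C_sw| * (C * δ * (A * (2 * C * ρ * ‖u‖))) := by
        gcongr
        exact (hR₁ d).trans (by gcongr)
      _ = D * (δ * ‖u‖) := by rw [hD]; ring
  have hδ0 := hδ.1
  have hB0 : 0 ≤ B := by positivity
  calc nw (R₁ v - R₀ v)
      ≤ B * (1 + L) * (M_w * (δ * ‖u‖)) + D * (δ * ‖u‖) := by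
        rw [hdiff]
        exact (hnw_add _ _).trans (add_le_add hhead htail)
    _ ≤ B * (1 + L) * (M_w * (δ * ‖u‖)) + D * (1 + L) * (δ * ‖u‖) := by
        gcongr
        exact le_mul_of_one_le_right hD0 (by linarith)
    _ = (B * M_w + D) * δ * (1 + L) * ‖u‖ := by ring
    _ ≤ (B * M_w + D) * δ * (1 + L) * (A * ‖v‖) := by gcongr
    _ = (B * M_w + D) * A * δ * (1 + L) * ‖v‖ := by ring
end

section
/- Let B be a real vector space with two norms ‖·‖_s and ‖·‖_w satisfying ‖v‖_w ≤ C_sw ‖v‖_s, with (B, ‖·‖_s) complete, and let ℓ : B → ℝ be a linear functional continuous for ‖·‖_s; set V := ker ℓ and assume V is ‖·‖_s-closed. Fix ε₀ > 0, C ≥ 1, ρ ∈ (0,1), M_w ≥ 1, M_s < ∞. For each ε ∈ [0, ε₀) and each n ∈ ℤ let L_n^ε : B → B be a linear map with ℓ(L_n^ε v) = ℓ(v) for all v. Assume: (H1) for each ε there is a family (μ_n^ε)_{n∈ℤ} with μ_{n+1}^ε = L_n^ε μ_n^ε, ℓ(μ_n^ε) = 1 and sup_{ε∈[0,ε₀)}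 sup_{n∈ℤ} ‖μ_n^ε‖_s ≤ M_s; (H2) there exist g_n ∈ B with sup_{n∈ℤ} ‖(L_n^ε μ_n^0 − L_n^0 μ_n^0)/ε − g_n‖_s → 0 as ε → 0⁺ and sup_{n∈ℤ} ‖g_n‖_s < ∞; (H3) there exist δ_ε → 0 as ε → 0⁺ with ‖(L_n^ε − L_n^0) v‖_w ≤ δ_ε ‖v‖_s for all n ∈ ℤ, v ∈ B; (H4) for every ε ∈ [0, ε₀), all integers m < n and all v ∈ V, ‖L_{n−1}^ε ∘ ⋯ ∘ L_m^ε v‖_s ≤ C ρ^{n−m} ‖v‖_s; (H5) for every ε, all m < n and all v ∈ V, ‖L_{n−1}^ε ∘ ⋯ ∘ L_m^ε v‖_w ≤ M_w ‖v‖_w. Define h_n^ε := (μ_n^ε − μ_n^0)/ε for 0 < ε < ε₀. Then: (1) sup_{0<ε<ε₀} sup_{n∈ℤ} ‖h_n^ε‖_s < ∞; (2) there exists a unique sequence (η_n)_{n∈ℤ} with η_n ∈ V, sup_n ‖η_n‖_s < ∞ and η_{n+1} = L_n^0 η_n + g_n for all n, and sup_{n∈ℤ} ‖h_n^ε − η_n‖_w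 → 0 as ε → 0⁺; (3) for every n ∈ ℤ, η_n = Σ_{k=0}^∞ L_{n−1}^0 ∘ ⋯ ∘ L_{n−k}^0 g_{n−k−1} (the k = 0 term being g_{n−1}), where Σ_{k=0}^∞ ‖L_{n−1}^0 ∘ ⋯ ∘ L_{n−k}^0 g_{n−k−1}‖_s converges, uniformly in n. -/
/-- `backComp L n k = L (n−1) ∘ ⋯ ∘ L (n−k)` : composition of `k` operators,
with `L (n−k)` applied first; `backComp L n 0` is the identity. -/
noncomputable def backComp {B : Type*} [AddCommGroup B] [Module ℝ B]
    (L : ℤ → (B →ₗ[ℝ] B)) (n : ℤ) : ℕ → (B →ₗ[ℝ] B)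
  | 0 => LinearMap.id
  | (k + 1) => backComp L n k ∘ₗ L (n - ((k : ℤ) + 1))

section BackComp

variable {B : Type*}

section Algebra

variable [AddCommGroup B] [Module ℝ B] (A : ℤ → (B →ₗ[ℝ] B))

theorem backComp_succ_apply (n : ℤ) (k : ℕ) (v : B) :
    backComp A n (k + 1) v = backComp A n k (A (n - ((k : ℤ) + 1)) v) := rfl

/-- The last factor of a backward composition can be split off on the left. -/
theorem backComp_add_one_succ_apply (n : ℤ) (k : ℕ) (v : B) :
    backComp A (n + 1) (k + 1) v = A n (backComp A n k v) := by
  induction k generalizing v with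
  | zero => simp [backComp]
  | succ k ih =>
    rw [backComp_succ_apply, ih, backComp_succ_apply]
    congr 4
    push_cast
    ring

/-- Discrete Duhamel formula for a solution of `x (n + 1) = A n (x n) + r n`. -/
theorem eq_backComp_add_sum {x r : ℤ → B} (hx : ∀ n, x (n + 1) = A n (x n) + r n)
    (n : ℤ) (N : ℕ) :
    x n = backComp A n N (x (n - N)) +
      ∑ k ∈ Finset.range N, backComp A n k (r (n - (k : ℤ) - 1)) := by
  induction N with
  | zero => simp [backComp]
  | succ N ih =>
    have h := hx (n - ((N : ℤ) + 1))
    rw [show n - ((N : ℤ) + 1) + 1 = n - N by ring] at h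
    rw [Finset.sum_range_succ, backComp_succ_apply]
    nth_rewrite 1 [ih]
    rw [h, map_add, show n - (N : ℤ) - 1 = n - ((N : ℤ) + 1) by ring]
    push_cast
    abel

theorem map_backComp_apply {ℓ : B → ℝ} (hℓ : ∀ n v, ℓ (A n v) = ℓ v) (n : ℤ) (k : ℕ) (v : B) :
    ℓ (backComp A n k v) = ℓ v := by
  induction k generalizing v with
  | zero => rfl
  | succ k ih => rw [backComp_succ_apply, ih, hℓ]

/-- Bounds on the compositions between times `m < n` bound all the compositions `backComp A n k`,
provided the bound also holds for the identity. -/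
theorem backComp_bound_of_lt {p q : B → ℝ} {c : ℕ → ℝ} {ℓ : B → ℝ}
    (h0 : ∀ v, p v ≤ c 0 * q v)
    (h : ∀ m n : ℤ, m < n → ∀ v, ℓ v = 0 →
      p (backComp A n (n - m).toNat v) ≤ c (n - m).toNat * q v)
    (n : ℤ) (k : ℕ) (v : B) (hv : ℓ v = 0) : p (backComp A n k v) ≤ c k * q v := by
  rcases k.eq_zero_or_pos with rfl | hk
  · exact h0 v
  · have := h (n - k) n (by omega) v hv
    rwa [show (n - (n - (k : ℤ))).toNat = k by omega] at this

end Algebra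

section Normed

variable [NormedAddCommGroup B] [NormedSpace ℝ B] {A : ℤ → (B →ₗ[ℝ] B)} {ℓ : B →L[ℝ] ℝ}
  {C ρ R : ℝ} {r : ℤ → B}

theorem norm_backComp_apply_le (hC : 0 ≤ C) (hρ : 0 ≤ ρ)
    (hA : ∀ n k v, ℓ v = 0 → ‖backComp A n k v‖ ≤ C * ρ ^ k * ‖v‖)
    (hr : ∀ n, ℓ (r n) = 0) (hR : ∀ n, ‖r n‖ ≤ R) (n m : ℤ) (k : ℕ) :
    ‖backComp A n k (r m)‖ ≤ C * R * ρ ^ k :=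
  (hA n k _ (hr m)).trans <| by
    calc C * ρ ^ k * ‖r m‖ ≤ C * ρ ^ k * R := by gcongr; exact hR m
      _ = C * R * ρ ^ k := by ring

/-- Bounded zero-mass solutions of `x (n + 1) = A n (x n) + r n` are controlled by the forcing. -/
theorem norm_le_of_bounded_recurrence (hC : 0 ≤ C) (hρ : ρ ∈ Set.Ioo (0 : ℝ) 1)
    (hA : ∀ n k v, ℓ v = 0 → ‖backComp A n k v‖ ≤ C * ρ ^ k * ‖v‖)
    (hr : ∀ n, ℓ (r n) = 0) (hR : ∀ n, ‖r n‖ ≤ R)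
    {x : ℤ → B} (hx0 : ∀ n, ℓ (x n) = 0) {M : ℝ} (hM : ∀ n, ‖x n‖ ≤ M)
    (hx : ∀ n, x (n + 1) = A n (x n) + r n) (n : ℤ) :
    ‖x n‖ ≤ C * R * (1 - ρ)⁻¹ := by
  have hR0 : 0 ≤ R := (norm_nonneg _).trans (hR 0)
  have hbound (N : ℕ) : ‖x n‖ ≤ C * M * ρ ^ N + C * R * (1 - ρ)⁻¹ := by
    rw [eq_backComp_add_sum A hx n N]
    refine (norm_add_le _ _).trans (add_le_add
      (norm_backComp_apply_le hC hρ.1.le hA hx0 hM n _ N) ?_)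
    refine (norm_sum_le_of_le _ fun k _ =>
      norm_backComp_apply_le hC hρ.1.le hA hr hR n _ k).trans ?_
    rw [← Finset.mul_sum]
    gcongr
    rw [← tsum_geometric_of_lt_one hρ.1.le hρ.2]
    exact (summable_geometric_of_lt_one hρ.1.le hρ.2).sum_le_tsum _
      fun k _ => pow_nonneg hρ.1.le k
  have hlim : Filter.Tendsto (fun N : ℕ => C * M * ρ ^ N + C * R * (1 - ρ)⁻¹) Filter.atTop
      (nhds (C * M * 0 + C * R * (1 - ρ)⁻¹)) :=
    ((tendsto_pow_atTop_nhds_zero_of_lt_one hρ.1.le hρ.2).const_mul _).add_const _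
  simpa using ge_of_tendsto' hlim hbound

/-- The causal series converges absolutely. -/
theorem summable_norm_backComp (hC : 0 ≤ C) (hρ : ρ ∈ Set.Ioo (0 : ℝ) 1)
    (hA : ∀ n k v, ℓ v = 0 → ‖backComp A n k v‖ ≤ C * ρ ^ k * ‖v‖)
    (hr : ∀ n, ℓ (r n) = 0) (hR : ∀ n, ‖r n‖ ≤ R) (n : ℤ) :
    Summable fun k : ℕ => ‖backComp A n k (r (n - (k : ℤ) - 1))‖ :=
  .of_nonneg_of_le (fun _ => norm_nonneg _)
    (fun k => norm_backComp_apply_le hC hρ.1.le hA hr hR n _ k)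
    ((summable_geometric_of_lt_one hρ.1.le hρ.2).mul_left _)

/-- The tails of the causal series are geometrically small, uniformly in time. -/
theorem tsum_norm_backComp_tail_le (hC : 0 ≤ C) (hρ : ρ ∈ Set.Ioo (0 : ℝ) 1)
    (hA : ∀ n k v, ℓ v = 0 → ‖backComp A n k v‖ ≤ C * ρ ^ k * ‖v‖)
    (hr : ∀ n, ℓ (r n) = 0) (hR : ∀ n, ‖r n‖ ≤ R) (n : ℤ) (N : ℕ) :
    ∑' k : ℕ, ‖backComp A n (N + k) (r (n - ((N : ℤ) + (k : ℤ)) - 1))‖ ≤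
      C * R * (1 - ρ)⁻¹ * ρ ^ N := by
  have hgeom := (hasSum_geometric_of_lt_one hρ.1.le hρ.2).mul_left (C * R * ρ ^ N)
  have hle (k : ℕ) : ‖backComp A n (N + k) (r (n - ((N : ℤ) + (k : ℤ)) - 1))‖ ≤
      C * R * ρ ^ N * ρ ^ k := by
    rw [mul_assoc, ← pow_add]
    exact norm_backComp_apply_le hC hρ.1.le hA hr hR n _ _
  calc _ ≤ ∑' k : ℕ, C * R * ρ ^ N * ρ ^ k :=
        (Summable.of_nonneg_of_le (fun _ => norm_nonneg _) hle hgeom.summable).tsum_le_tsum hle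
          hgeom.summable
    _ = C * R * (1 - ρ)⁻¹ * ρ ^ N := by rw [hgeom.tsum_eq]; ring

/-- The causal series solves the recurrence. -/
theorem causal_sum_recurrence
    (hA : ∀ n k v, ℓ v = 0 → ‖backComp A n k v‖ ≤ C * ρ ^ k * ‖v‖)
    (hℓ : ∀ n v, ℓ (A n v) = ℓ v) (hr : ∀ n, ℓ (r n) = 0) {x : ℤ → B}
    (hx0 : ∀ n, ℓ (x n) = 0)
    (hx : ∀ n, HasSum (fun k : ℕ => backComp A n k (r (n - (k : ℤ) - 1))) (x n)) (n : ℤ) :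
    x (n + 1) = A n (x n) + r n := by
  set S : ℕ → B := fun N => ∑ k ∈ Finset.range N, backComp A n k (r (n - (k : ℤ) - 1))
  have hS : Filter.Tendsto S Filter.atTop (nhds (x n)) := (hx n).tendsto_sum_nat
  have hS0 (N : ℕ) : ℓ (S N) = 0 := by
    simp only [S, map_sum]
    exact Finset.sum_eq_zero fun k _ => by rw [map_backComp_apply A hℓ, hr]
  have hAS : Filter.Tendsto (fun N => A n (S N)) Filter.atTop (nhds (A n (x n))) := by
    rw [tendsto_iff_norm_sub_tendsto_zero] at hS ⊢
    refine squeeze_zero (fun _ => norm_nonneg _) (fun N => ?_)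
      (by simpa using hS.const_mul (C * ρ ^ 1))
    have := hA (n + 1) 1 (S N - x n) (by rw [map_sub, hS0, hx0, sub_zero])
    rwa [backComp_add_one_succ_apply, backComp, LinearMap.id_apply, map_sub] at this
  have hsucc : Filter.Tendsto (fun N => A n (S N) + r n) Filter.atTop (nhds (x (n + 1))) := by
    refine ((Filter.tendsto_add_atTop_iff_nat 1).2 (hx (n + 1)).tendsto_sum_nat).congr
      fun N => ?_
    rw [Finset.sum_range_succ', map_sum]
    congr 1
    · refine Finset.sum_congr rfl fun k _ => ?_
      rw [backComp_add_one_succ_apply]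
      congr 4
      push_cast
      ring
    · simp [backComp]
  exact tendsto_nhds_unique hsucc (hAS.add_const _)

/-- Finite-horizon estimate in a weak seminorm `nw`: memory of the initial state is lost in the
strong norm, while the forcing is accumulated in the weak one. -/
theorem weak_le_of_recurrence (nw : Seminorm ℝ B) {K M_w M b : ℝ} (hK : 0 ≤ K)
    (hC : 0 ≤ C) (hρ : 0 ≤ ρ) (hMw : 0 ≤ M_w) (hnw : ∀ v, nw v ≤ K * ‖v‖)
    (hA : ∀ n k v, ℓ v = 0 → ‖backComp A n k v‖ ≤ C * ρ ^ k * ‖v‖)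
    (hAw : ∀ n k v, ℓ v = 0 → nw (backComp A n k v) ≤ M_w * nw v)
    (hr : ∀ n, ℓ (r n) = 0) (hb : ∀ n, nw (r n) ≤ b)
    {x : ℤ → B} (hx0 : ∀ n, ℓ (x n) = 0) (hM : ∀ n, ‖x n‖ ≤ M)
    (hx : ∀ n, x (n + 1) = A n (x n) + r n) (n : ℤ) (N : ℕ) :
    nw (x n) ≤ K * (C * M) * ρ ^ N + N * (M_w * b) := by
  rw [eq_backComp_add_sum A hx n N]
  refine (map_add_le_add nw _ _).trans (add_le_add ?_ ?_)
  · refine (hnw _).trans ?_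
    rw [mul_assoc]
    gcongr
    exact norm_backComp_apply_le hC hρ hA hx0 hM n _ N
  · refine (Finset.le_sum_of_subadditive nw (map_zero nw).le (map_add_le_add nw) _ _).trans ?_
    calc _ ≤ ∑ k ∈ Finset.range N, M_w * b := by
          refine Finset.sum_le_sum fun k _ => (hAw _ _ _ (hr _)).trans ?_
          gcongr
          exact hb _
      _ = N * (M_w * b) := by simp

end Normed

end BackComp

/-- A sequence dominated by `a * ρ ^ N` with `ρ < 1` is eventually below any positive level. -/
theorem exists_mul_pow_le {ρ : ℝ} (hρ : ρ ∈ Set.Ioo (0 : ℝ) 1) (a : ℝ) {e : ℝ} (he : 0 < e) :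
    ∃ N : ℕ, a * ρ ^ N ≤ e := by
  have h := (tendsto_pow_atTop_nhds_zero_of_lt_one hρ.1.le hρ.2).const_mul a
  rw [mul_zero] at h
  exact (h.eventually_le_const he).exists

/-- Abstract linear response theorem for nonautonomous systems (via the global-map
resolvent).  `B` carries a strong norm `‖·‖` (complete) and a weak norm `nw ≤ C_sw ‖·‖`;
`ℓ` is a strongly continuous mass functional preserved by all the operators `L_n^ε`.
Under (H1) uniform strong bounds for the equivariant families, (H2) strong
differentiability of the operators along the unperturbed family, (H3) mixed-norm
closeness, (H4) uniform exponential loss of memory in the strong norm and (H5) weak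
power boundedness on the zero-mass subspace:
(1) the difference quotients `h_n^ε = (μ_n^ε − μ_n^0)/ε` are uniformly bounded in
the strong norm; (2) there is a unique bounded zero-mass sequence `η` with
`η_{n+1} = L_n^0 η_n + g_n`, and `h^ε → η` uniformly in the weak norm as `ε → 0⁺`;
(3) `η_n` is the sum of the causal series `Σ_k L_{n−1}^0 ⋯ L_{n−k}^0 g_{n−k−1}`,
absolutely convergent in the strong norm, uniformly in `n`. -/
theorem linear_response_nonautonomous
    {B : Type*} [NormedAddCommGroup B] [NormedSpace ℝ B] [CompleteSpace B]
    (nw : B → ℝ)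
    (hnw_nonneg : ∀ v, 0 ≤ nw v)
    (hnw_add : ∀ u v, nw (u + v) ≤ nw u + nw v)
    (hnw_smul : ∀ (c : ℝ) (v : B), nw (c • v) = |c| * nw v)
    (hnw_def : ∀ v, nw v = 0 → v = 0)
    (C_sw : ℝ) (hsw : ∀ v, nw v ≤ C_sw * ‖v‖)
    (ℓ : B →L[ℝ] ℝ)
    (ε₀ C ρ M_w M_s : ℝ) (hε₀ : 0 < ε₀) (hC : 1 ≤ C)
    (hρ : ρ ∈ Set.Ioo (0 : ℝ) 1) (hMw : 1 ≤ M_w)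
    (L : ℝ → ℤ → (B →ₗ[ℝ] B))
    (hmass : ∀ ε ∈ Set.Ico (0 : ℝ) ε₀, ∀ (n : ℤ) (v : B), ℓ (L ε n v) = ℓ v)
    -- (H1) equivariant families, uniformly bounded in the strong norm
    (μ : ℝ → ℤ → B)
    (hμeq : ∀ ε ∈ Set.Ico (0 : ℝ) ε₀, ∀ n : ℤ, μ ε (n + 1) = L ε n (μ ε n))
    (hμmass : ∀ ε ∈ Set.Ico (0 : ℝ) ε₀, ∀ n : ℤ, ℓ (μ ε n) = 1)
    (hμbd : ∀ ε ∈ Set.Ico (0 : ℝ) ε₀, ∀ n : ℤ, ‖μ ε n‖ ≤ M_s)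
    -- (H2) strong differentiability along the unperturbed family
    (g : ℤ → B)
    (hg_lim : ∀ e > (0 : ℝ), ∃ εb > (0 : ℝ), ∀ ε : ℝ, 0 < ε → ε < εb → ε < ε₀ →
      ∀ n : ℤ, ‖ε⁻¹ • (L ε n (μ 0 n) - L 0 n (μ 0 n)) - g n‖ ≤ e)
    (hg_bd : ∃ G : ℝ, ∀ n : ℤ, ‖g n‖ ≤ G)
    -- (H3) mixed-norm closeness
    (δ : ℝ → ℝ)
    (hδ_lim : ∀ e > (0 : ℝ), ∃ εb > (0 : ℝ), ∀ ε : ℝ, 0 < ε → ε < εb → δ ε ≤ e)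
    (hδ : ∀ ε ∈ Set.Ico (0 : ℝ) ε₀, ∀ (n : ℤ) (v : B),
      nw (L ε n v - L 0 n v) ≤ δ ε * ‖v‖)
    -- (H4) uniform exponential loss of memory in the strong norm
    (hELoM : ∀ ε ∈ Set.Ico (0 : ℝ) ε₀, ∀ (m n : ℤ), m < n → ∀ v : B, ℓ v = 0 →
      ‖backComp (L ε) n ((n - m).toNat) v‖ ≤ C * ρ ^ ((n - m).toNat) * ‖v‖)
    -- (H5) weak power boundedness on the zero-mass subspace
    (hWeak : ∀ ε ∈ Set.Ico (0 : ℝ) ε₀, ∀ (m n : ℤ), m < n → ∀ v : B, ℓ v = 0 →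
      nw (backComp (L ε) n ((n - m).toNat) v) ≤ M_w * nw v) :
    -- (1) uniform strong boundedness of the difference quotients
    (∃ H : ℝ, ∀ ε : ℝ, 0 < ε → ε < ε₀ → ∀ n : ℤ, ‖ε⁻¹ • (μ ε n - μ 0 n)‖ ≤ H) ∧
    -- (2) and (3)
    (∃ η : ℤ → B,
      (∀ n : ℤ, ℓ (η n) = 0) ∧
      (∃ Mη : ℝ, ∀ n : ℤ, ‖η n‖ ≤ Mη) ∧
      (∀ n : ℤ, η (n + 1) = L 0 n (η n) + g n) ∧
      (∀ η' : ℤ → B, (∀ n : ℤ, ℓ (η' n) = 0) → (∃ M' : ℝ, ∀ n : ℤ, ‖η' n‖ ≤ M') →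
        (∀ n : ℤ, η' (n + 1) = L 0 n (η' n) + g n) → η' = η) ∧
      (∀ e > (0 : ℝ), ∃ εb > (0 : ℝ), ∀ ε : ℝ, 0 < ε → ε < εb → ε < ε₀ →
        ∀ n : ℤ, nw (ε⁻¹ • (μ ε n - μ 0 n) - η n) ≤ e) ∧
      (∀ n : ℤ, HasSum (fun k : ℕ => backComp (L 0) n k (g (n - (k : ℤ) - 1))) (η n)) ∧
      (∀ n : ℤ, Summable (fun k : ℕ => ‖backComp (L 0) n k (g (n - (k : ℤ) - 1))‖)) ∧
      (∀ e > (0 : ℝ), ∃ N : ℕ, ∀ n : ℤ,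
        ∑' k : ℕ, ‖backComp (L 0) n (N + k) (g (n - ((N : ℤ) + (k : ℤ)) - 1))‖ ≤ e)) := by
  have hC0 : 0 ≤ C := by linarith
  have hMw0 : 0 ≤ M_w := by linarith
  have h0mem : (0 : ℝ) ∈ Set.Ico (0 : ℝ) ε₀ := ⟨le_rfl, hε₀⟩
  have hA : ∀ ε ∈ Set.Ico (0 : ℝ) ε₀, ∀ n k v, ℓ v = 0 →
      ‖backComp (L ε) n k v‖ ≤ C * ρ ^ k * ‖v‖ := fun ε hε n k v =>
    backComp_bound_of_lt (L ε) (p := norm) (q := norm) (c := fun k => C * ρ ^ k) (ℓ := ℓ)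
      (fun v => by simpa using le_mul_of_one_le_left (norm_nonneg v) hC) (hELoM ε hε) n k v
  let p : Seminorm ℝ B := Seminorm.of nw hnw_add hnw_smul
  have hAw : ∀ n k v, ℓ v = 0 → p (backComp (L 0) n k v) ≤ M_w * p v := fun n k v =>
    backComp_bound_of_lt (L 0) (p := nw) (q := nw) (c := fun _ => M_w) (ℓ := ℓ)
      (fun v => le_mul_of_one_le_left (hnw_nonneg v) hMw) (hWeak 0 h0mem) n k v
  have hp (v : B) : p v ≤ |C_sw| * ‖v‖ :=
    (hsw v).trans (mul_le_mul_of_nonneg_right (le_abs_self _) (norm_nonneg v))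
  let f : ℝ → ℤ → B := fun ε n => ε⁻¹ • (L ε n (μ 0 n) - L 0 n (μ 0 n))
  let h : ℝ → ℤ → B := fun ε n => ε⁻¹ • (μ ε n - μ 0 n)
  have hmem {ε : ℝ} (hε : 0 < ε) (hε' : ε < ε₀) : ε ∈ Set.Ico (0 : ℝ) ε₀ := ⟨hε.le, hε'⟩
  have hf0 {ε : ℝ} (hε : 0 < ε) (hε' : ε < ε₀) (n : ℤ) : ℓ (f ε n) = 0 := by
    simp [f, hmass ε (hmem hε hε'), hmass 0 h0mem]
  have hh0 {ε : ℝ} (hε : 0 < ε) (hε' : ε < ε₀) (n : ℤ) : ℓ (h ε n) = 0 := by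
    simp [h, hμmass ε (hmem hε hε'), hμmass 0 h0mem]
  have hh_rec {ε : ℝ} (hε : 0 < ε) (hε' : ε < ε₀) (n : ℤ) :
      h ε (n + 1) = L ε n (h ε n) + f ε n := by
    simp only [h, f, hμeq ε (hmem hε hε'), hμeq 0 h0mem, map_smul, map_sub, ← smul_add]
    congr 1
    abel
  have hh_bd {ε : ℝ} (hε : 0 < ε) (hε' : ε < ε₀) (n : ℤ) : ‖h ε n‖ ≤ ε⁻¹ * (M_s + M_s) := by
    rw [norm_smul, Real.norm_of_nonneg (inv_nonneg.2 hε.le)]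
    gcongr
    exact (norm_sub_le _ _).trans
      (add_le_add (hμbd ε (hmem hε hε') n) (hμbd 0 h0mem n))
  have hMs : 0 ≤ M_s := (norm_nonneg _).trans (hμbd 0 h0mem 0)
  obtain ⟨G, hG⟩ := hg_bd
  have hg0 (n : ℤ) : ℓ (g n) = 0 := by
    have hsmall : ∀ e > 0, |ℓ (g n)| ≤ 0 + e := by
      intro e he
      obtain ⟨εb, hεb, hlim⟩ := hg_lim (e / (‖ℓ‖ + 1)) (by positivity)
      have hε : 0 < min εb ε₀ / 2 := by positivity
      have hεεb : min εb ε₀ / 2 < εb := by have := min_le_left εb ε₀; linarith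
      have hεε₀ : min εb ε₀ / 2 < ε₀ := by have := min_le_right εb ε₀; linarith
      have hle := hlim _ hε hεεb hεε₀ n
      have hℓ := ℓ.le_opNorm (f (min εb ε₀ / 2) n - g n)
      rw [map_sub, hf0 hε hεε₀, zero_sub, norm_neg, Real.norm_eq_abs] at hℓ
      calc |ℓ (g n)| ≤ ‖ℓ‖ * (e / (‖ℓ‖ + 1)) := hℓ.trans (by gcongr)
        _ ≤ (‖ℓ‖ + 1) * (e / (‖ℓ‖ + 1)) := by gcongr; linarith
        _ = 0 + e := by field_simp; ring
    exact abs_nonpos_iff.1 (le_of_forall_pos_le_add hsmall)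
  have hH : ∃ H : ℝ, ∀ ε : ℝ, 0 < ε → ε < ε₀ → ∀ n : ℤ, ‖h ε n‖ ≤ H := by
    obtain ⟨εb, hεb, hlim⟩ := hg_lim 1 one_pos
    refine ⟨max (C * (1 + G) * (1 - ρ)⁻¹) (εb⁻¹ * (M_s + M_s)), fun ε hε hε' n => ?_⟩
    rcases lt_or_ge ε εb with hlt | hge
    · refine le_max_of_le_left (norm_le_of_bounded_recurrence hC0 hρ (hA ε (hmem hε hε'))
        (hf0 hε hε') (fun m => ?_) (hh0 hε hε') (hh_bd hε hε') (hh_rec hε hε') n)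
      have := norm_add_le (f ε m - g m) (g m)
      rw [sub_add_cancel] at this
      exact this.trans (add_le_add (hlim ε hε hlt hε' m) (hG m))
    · exact le_max_of_le_right ((hh_bd hε hε' n).trans (by gcongr))
  have hsum := summable_norm_backComp hC0 hρ (hA 0 h0mem) hg0 hG
  let η : ℤ → B := fun n => ∑' k : ℕ, backComp (L 0) n k (g (n - (k : ℤ) - 1))
  have hηsum (n : ℤ) :
      HasSum (fun k : ℕ => backComp (L 0) n k (g (n - (k : ℤ) - 1))) (η n) :=
    (hsum n).of_norm.hasSum
  have hη0 (n : ℤ) : ℓ (η n) = 0 := by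
    refine ((hηsum n).mapL ℓ).unique ?_
    simp only [map_backComp_apply (L 0) (hmass 0 h0mem), hg0]
    exact hasSum_zero
  have hη_rec := causal_sum_recurrence (hA 0 h0mem) (hmass 0 h0mem) hg0 hη0 hηsum
  have hη_bd (n : ℤ) : ‖η n‖ ≤ C * G * (1 - ρ)⁻¹ := by
    refine (norm_tsum_le_tsum_norm (hsum n)).trans ?_
    simpa using tsum_norm_backComp_tail_le hC0 hρ (hA 0 h0mem) hg0 hG n 0
  refine ⟨hH, η, hη0, ⟨_, hη_bd⟩, hη_rec, ?_, ?_, hηsum, hsum, ?_⟩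
  · rintro η' hη'0 ⟨M', hM'⟩ hη'_rec
    funext n
    have := norm_le_of_bounded_recurrence (x := fun n => η' n - η n) (r := fun _ => 0) (R := 0)
      hC0 hρ (hA 0 h0mem) (by simp) (by simp) (fun n => by simp [hη'0, hη0])
      (fun n => (norm_sub_le _ _).trans (add_le_add (hM' n) (hη_bd n)))
      (fun n => by rw [hη'_rec, hη_rec, map_sub]; abel) n
    rw [mul_zero, zero_mul] at this
    exact sub_eq_zero.1 (norm_le_zero_iff.1 this)
  · intro e he
    obtain ⟨H, hH⟩ := hH
    obtain ⟨N, hN⟩ := exists_mul_pow_le hρ (|C_sw| * (C * (H + C * G * (1 - ρ)⁻¹))) (half_pos he)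
    have hH0 : 0 ≤ H := (norm_nonneg _).trans
      (hH (ε₀ / 2) (by positivity) (by linarith) 0)
    let κ : ℝ := N * M_w * (H + |C_sw|)
    have hκ : 0 ≤ κ := by positivity
    have hτ : 0 < e / 2 / (κ + 1) := by positivity
    obtain ⟨ε₁, hε₁, hlim₁⟩ := hg_lim _ hτ
    obtain ⟨ε₂, hε₂, hlim₂⟩ := hδ_lim _ hτ
    refine ⟨min ε₁ ε₂, lt_min hε₁ hε₂, fun ε hε hεb hε' n => ?_⟩
    have hd_rec (m : ℤ) : h ε (m + 1) - η (m + 1) = L 0 m (h ε m - η m) +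
        ((L ε m (h ε m) - L 0 m (h ε m)) + (f ε m - g m)) := by
      rw [hh_rec hε hε', hη_rec, map_sub]
      abel
    have hr0 (m : ℤ) : ℓ ((L ε m (h ε m) - L 0 m (h ε m)) + (f ε m - g m)) = 0 := by
      simp [hmass ε (hmem hε hε'), hmass 0 h0mem, hf0 hε hε', hg0]
    have hrw (m : ℤ) : p ((L ε m (h ε m) - L 0 m (h ε m)) + (f ε m - g m)) ≤
        e / 2 / (κ + 1) * (H + |C_sw|) := by
      rw [mul_add]
      refine (map_add_le_add p _ _).trans (add_le_add ?_ ?_)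
      · refine (hδ ε (hmem hε hε') m _).trans ?_
        gcongr
        · exact hlim₂ ε hε (hεb.trans_le (min_le_right _ _))
        · exact hH ε hε hε' m
      · rw [mul_comm]
        refine (hp _).trans ?_
        gcongr
        exact hlim₁ ε hε (hεb.trans_le (min_le_left _ _)) hε' m
    have hfin := weak_le_of_recurrence p (abs_nonneg C_sw) hC0 hρ.1.le hMw0 hp (hA 0 h0mem) hAw
      hr0 hrw (x := fun m => h ε m - η m) (fun m => by simp [hh0 hε hε', hη0])
      (fun m => (norm_sub_le _ _).trans (add_le_add (hH ε hε hε' m) (hη_bd m))) hd_rec n N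
    calc nw (h ε n - η n)
        ≤ |C_sw| * (C * (H + C * G * (1 - ρ)⁻¹)) * ρ ^ N +
          N * (M_w * (e / 2 / (κ + 1) * (H + |C_sw|))) := hfin
      _ = |C_sw| * (C * (H + C * G * (1 - ρ)⁻¹)) * ρ ^ N + κ * (e / 2 / (κ + 1)) := by
          simp only [κ]; ring
      _ ≤ e / 2 + (κ + 1) * (e / 2 / (κ + 1)) := by gcongr; linarith
      _ = e := by field_simp; ring
  · intro e he
    obtain ⟨N, hN⟩ := exists_mul_pow_le hρ (C * G * (1 - ρ)⁻¹) he
    exact ⟨N, fun n => (tsum_norm_backComp_tail_le hC0 hρ (hA 0 h0mem) hg0 hG n N).trans hN⟩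
end

section
/- Let B be a real vector space with two norms ‖·‖_s and ‖·‖_w satisfying ‖v‖_w ≤ ‖v‖_s. Let L₀ : B → B and (L_i)_{i∈ℕ} be linear maps, all satisfying the common one-step Lasota–Yorke inequalities with constants λ₁ ∈ [0,1) and B₀ ≥ 0: ‖L f‖_w ≤ ‖f‖_w and ‖L f‖_s ≤ λ₁ ‖f‖_s + B₀ ‖f‖_w for L ∈ {L₀} ∪ {L_i}. Let δ ≥ 0 and assume ‖(L_i − L₀) v‖_w ≤ δ ‖v‖_s for all i and all v ∈ B. Then for every g ∈ B, every j and every n ≥ 1, the sequential composition L^{(j,j+n−1)} := L_j ∘ L_{j+1} ∘ ⋯ ∘ L_{j+n−1} satisfies ‖L^{(j,j+n−1)} g − L₀^n g‖_w ≤ δ ( (1/(1 − λ₁)) ‖g‖_s + n (B₀/(1 − λ₁)) ‖g‖_w ). -/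
/-- `fwdComp L j n = L j ∘ L (j+1) ∘ ⋯ ∘ L (j+n−1)` : the sequential composition
`L^{(j,j+n−1)}` of `n` operators, with `L (j+n−1)` applied first and `L j` applied last.
`fwdComp L j 0` is the identity. -/
noncomputable def fwdComp {B : Type*} [AddCommGroup B] [Module ℝ B]
    (L : ℕ → (B →ₗ[ℝ] B)) (j : ℕ) : ℕ → (B →ₗ[ℝ] B)
  | 0 => LinearMap.id
  | (n + 1) => fwdComp L j n ∘ₗ L (j + n)

/-- A sequential composition of weak contractions is a weak contraction. -/
theorem weak_fwdComp_le {B : Type*} [AddCommGroup B] [Module ℝ B] (nw : B → ℝ)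
    (L : ℕ → (B →ₗ[ℝ] B)) (hL : ∀ (i : ℕ) (f : B), nw (L i f) ≤ nw f) (j n : ℕ) (f : B) :
    nw (fwdComp L j n f) ≤ nw f := by
  induction n generalizing f with
  | zero => exact le_rfl
  | succ n ih => exact (ih (L (j + n) f)).trans (hL (j + n) f)

/-- Distance (in the weak norm) of a sequential composition from the iterates of the
reference operator `L₀`: if all operators satisfy a common Lasota–Yorke inequality and
`‖(L_i − L₀)v‖_w ≤ δ ‖v‖_s` for all `i`, then
`‖L^{(j,j+n−1)} g − L₀ⁿ g‖_w ≤ δ ((1/(1−λ₁))‖g‖_s + n (B₀/(1−λ₁)) ‖g‖_w)`. -/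
theorem sequential_composition_close_to_iterates
    {B : Type*} [NormedAddCommGroup B] [NormedSpace ℝ B]
    (nw : B → ℝ)
    (hnw_nonneg : ∀ v, 0 ≤ nw v)
    (hnw_add : ∀ u v, nw (u + v) ≤ nw u + nw v)
    (hnw_smul : ∀ (c : ℝ) (v : B), nw (c • v) = |c| * nw v)
    (hnw_def : ∀ v, nw v = 0 → v = 0)
    (hwle : ∀ v, nw v ≤ ‖v‖)
    (L₀ : B →ₗ[ℝ] B) (L : ℕ → (B →ₗ[ℝ] B))
    (lam₁ B₀ : ℝ) (hlam : lam₁ ∈ Set.Ico (0 : ℝ) 1) (hB₀ : 0 ≤ B₀)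
    (hLY₀w : ∀ f : B, nw (L₀ f) ≤ nw f)
    (hLY₀s : ∀ f : B, ‖L₀ f‖ ≤ lam₁ * ‖f‖ + B₀ * nw f)
    (hLYw : ∀ (i : ℕ) (f : B), nw (L i f) ≤ nw f)
    (hLYs : ∀ (i : ℕ) (f : B), ‖L i f‖ ≤ lam₁ * ‖f‖ + B₀ * nw f)
    (δ : ℝ) (hδ : 0 ≤ δ)
    (hclose : ∀ (i : ℕ) (v : B), nw (L i v - L₀ v) ≤ δ * ‖v‖) :
    ∀ (g : B) (j n : ℕ), 1 ≤ n →
      nw (fwdComp L j n g - (L₀ ^ n) g) ≤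
        δ * ((1 / (1 - lam₁)) * ‖g‖ + (n : ℝ) * (B₀ / (1 - lam₁)) * nw g) := by
  intro g j n hn
  clear hn
  obtain ⟨hlam0, hlam1⟩ := hlam
  have hpos : 0 < 1 - lam₁ := sub_pos.mpr hlam1
  have hnw_zero : nw 0 = 0 := by simpa using hnw_smul 0 0
  induction n generalizing g with
  | zero =>
    have hng := hnw_nonneg g
    simp only [fwdComp, pow_zero, LinearMap.id_apply, Module.End.one_apply, sub_self, hnw_zero]
    positivity
  | succ n ih =>
    have hsplit : fwdComp L j (n + 1) g - (L₀ ^ (n + 1)) g =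
        fwdComp L j n (L (j + n) g - L₀ g) + (fwdComp L j n (L₀ g) - (L₀ ^ n) (L₀ g)) := by
      simp [fwdComp, pow_succ]
    have hfirst : nw (fwdComp L j n (L (j + n) g - L₀ g)) ≤ δ * ‖g‖ :=
      (weak_fwdComp_le nw L hLYw j n _).trans (hclose _ g)
    calc nw (fwdComp L j (n + 1) g - (L₀ ^ (n + 1)) g)
        ≤ nw (fwdComp L j n (L (j + n) g - L₀ g)) +
            nw (fwdComp L j n (L₀ g) - (L₀ ^ n) (L₀ g)) := hsplit ▸ hnw_add _ _
      _ ≤ δ * ‖g‖ + δ * ((1 / (1 - lam₁)) * ‖L₀ g‖ +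
            (n : ℝ) * (B₀ / (1 - lam₁)) * nw (L₀ g)) := add_le_add hfirst (ih (L₀ g))
      _ ≤ δ * ‖g‖ + δ * ((1 / (1 - lam₁)) * (lam₁ * ‖g‖ + B₀ * nw g) +
            (n : ℝ) * (B₀ / (1 - lam₁)) * nw g) := by
          gcongr
          · exact hLY₀s g
          · exact hLY₀w g
      _ = δ * ((1 / (1 - lam₁)) * ‖g‖ + ((n + 1 : ℕ) : ℝ) * (B₀ / (1 - lam₁)) * nw g) := by
          push_cast
          field_simp
          ring
end

section
/- Let B be a real vector space with two norms ‖·‖_s and ‖·‖_w satisfying ‖v‖_w ≤ ‖v‖_s, let ℓ : B → ℝ be a linear functional, and set V := ker ℓ. Let L₀ : B → B and (L_i)_{i∈ℕ} be linear maps with ℓ(L v) = ℓ(v) for each such L and all v ∈ B, satisfying: (ML1) the common Lasota–Yorke inequalities ‖L f‖_w ≤ ‖f‖_w and ‖L f‖_s ≤ λ₁ ‖f‖_s + B₀ ‖f‖_w for all f, with λ₁ ∈ (0,1), B₀ > 0; (ML2) there exists M ∈ ℕ, M ≥ 1, with λ₁^M ≤ 1/(10(B₀/(1−λ₁) + 1))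 and ‖L₀^M v‖_w ≤ ((1−λ₁)/(10 B₀)) ‖v‖_s for all v ∈ V; (ML3) for every i, ‖(L_i − L₀) v‖_w ≤ (7(1−λ₁)²/(10 M B₀ (1/(1−λ₁) + B₀))) ‖v‖_s for all v ∈ B. Then the sequence (L_i) has strong exponential loss of memory: there exist constants C ≥ 0 and λ > 0 such that for all j, n ∈ ℕ and all g ∈ V, ‖L^{(j,j+n−1)} g‖_s ≤ C e^{−λ n} ‖g‖_s, where L^{(j,j+n−1)} := L_j ∘ L_{j+1} ∘ ⋯ ∘ L_{j+n−1}. -/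
theorem fwdComp_add {B : Type*} [AddCommGroup B] [Module ℝ B]
    (L : ℕ → (B →ₗ[ℝ] B)) (j m n : ℕ) (v : B) :
    fwdComp L j (m + n) v = fwdComp L j m (fwdComp L (j + m) n v) := by
  induction n generalizing v with
  | zero => rfl
  | succ n ih =>
    change fwdComp L j (m + n) (L (j + (m + n)) v) = _
    rw [ih, ← add_assoc]
    rfl

theorem fwdComp_const {B : Type*} [AddCommGroup B] [Module ℝ B]
    (T : B →ₗ[ℝ] B) (j n : ℕ) : fwdComp (fun _ => T) j n = T ^ n := by
  induction n with
  | zero => rfl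
  | succ n ih => rw [fwdComp, ih, pow_succ]; rfl

theorem fwdComp_mass {B : Type*} [AddCommGroup B] [Module ℝ B]
    {ℓ : B →ₗ[ℝ] ℝ} {L : ℕ → (B →ₗ[ℝ] B)}
    (hmass : ∀ (i : ℕ) (v : B), ℓ (L i v) = ℓ v) (j n : ℕ) (v : B) :
    ℓ (fwdComp L j n v) = ℓ v := by
  induction n generalizing v with
  | zero => rfl
  | succ n ih => exact (ih _).trans (hmass _ _)

theorem fwdComp_weak_le {B : Type*} [AddCommGroup B] [Module ℝ B]
    {nw : B → ℝ} {L : ℕ → (B →ₗ[ℝ] B)}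
    (hw : ∀ (i : ℕ) (f : B), nw (L i f) ≤ nw f) (j n : ℕ) (v : B) :
    nw (fwdComp L j n v) ≤ nw v := by
  induction n generalizing v with
  | zero => rfl
  | succ n ih => exact (ih _).trans (hw _ _)

/-- The iterated Lasota–Yorke inequality. -/
theorem fwdComp_norm_le {B : Type*} [NormedAddCommGroup B] [NormedSpace ℝ B]
    {nw : B → ℝ} {L : ℕ → (B →ₗ[ℝ] B)} {lam K : ℝ} (hnw : ∀ v, 0 ≤ nw v)
    (hlam : lam ∈ Set.Ioo (0 : ℝ) 1) (hK : 0 < K)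
    (hw : ∀ (i : ℕ) (f : B), nw (L i f) ≤ nw f)
    (hs : ∀ (i : ℕ) (f : B), ‖L i f‖ ≤ lam * ‖f‖ + K * nw f) (j n : ℕ) (v : B) :
    ‖fwdComp L j n v‖ ≤ lam ^ n * ‖v‖ + K / (1 - lam) * nw v := by
  have ha : 0 < 1 - lam := sub_pos.2 hlam.2
  induction n generalizing j with
  | zero =>
    have := mul_nonneg (div_pos hK ha).le (hnw v)
    simpa [fwdComp] using this
  | succ n ih =>
    rw [add_comm n 1, fwdComp_add]
    have h1 := hs j (fwdComp L (j + 1) n v)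
    have h2 := mul_le_mul_of_nonneg_left (ih (j + 1)) hlam.1.le
    have h3 := mul_le_mul_of_nonneg_left (fwdComp_weak_le hw (j + 1) n v) hK.le
    calc _ ≤ lam * (lam ^ n * ‖v‖ + K / (1 - lam) * nw v) + K * nw v :=
          h1.trans (add_le_add h2 h3)
      _ = _ := by field_simp; ring

theorem fwdComp_sub_pow_weak_le {B : Type*} [NormedAddCommGroup B] [NormedSpace ℝ B]
    {nw : B → ℝ} {L : ℕ → (B →ₗ[ℝ] B)} {T : B →ₗ[ℝ] B} {ε : ℝ} (h0 : nw 0 = 0)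
    (hadd : ∀ u v, nw (u + v) ≤ nw u + nw v)
    (hw : ∀ (i : ℕ) (f : B), nw (L i f) ≤ nw f)
    (hclose : ∀ (i : ℕ) (v : B), nw (L i v - T v) ≤ ε * ‖v‖) (j n : ℕ) (v : B) :
    nw (fwdComp L j n v - (T ^ n) v) ≤ ε * ∑ k ∈ Finset.range n, ‖(T ^ k) v‖ := by
  induction n generalizing v with
  | zero => simp [fwdComp, h0]
  | succ n ih =>
    have e : fwdComp L j (n + 1) v - (T ^ (n + 1)) v
        = fwdComp L j n (L (j + n) v - T v) + (fwdComp L j n (T v) - (T ^ n) (T v)) := by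
      rw [map_sub, pow_succ]
      simp [fwdComp]
    rw [e, Finset.sum_range_succ', mul_add, add_comm (ε * _)]
    refine (hadd _ _).trans (add_le_add ?_ ?_)
    · exact (fwdComp_weak_le hw _ _ _).trans (hclose _ _)
    · simpa [pow_succ] using ih (T v)

/-- Strong exponential loss of memory for sequential compositions of mass-preserving
operators close to a reference operator `L₀` (Appendix A): under the common
Lasota–Yorke inequalities (ML1), the weak contraction estimate (ML2) for `L₀^M` on the
zero-mass subspace `V = ker ℓ`, and the mixed-norm closeness estimate (ML3), there are
`C ≥ 0` and `λ > 0` such that `‖L^{(j,j+n−1)} g‖_s ≤ C e^{−λ n} ‖g‖_s` for all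
`j, n ∈ ℕ` and all `g ∈ V`. -/
theorem strong_exponential_loss_of_memory
    {B : Type*} [NormedAddCommGroup B] [NormedSpace ℝ B]
    (nw : B → ℝ)
    (hnw_nonneg : ∀ v, 0 ≤ nw v)
    (hnw_add : ∀ u v, nw (u + v) ≤ nw u + nw v)
    (hnw_smul : ∀ (c : ℝ) (v : B), nw (c • v) = |c| * nw v)
    (hnw_def : ∀ v, nw v = 0 → v = 0)
    (hwle : ∀ v, nw v ≤ ‖v‖)
    (ℓ : B →ₗ[ℝ] ℝ)
    (L₀ : B →ₗ[ℝ] B) (L : ℕ → (B →ₗ[ℝ] B))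
    (hmass₀ : ∀ v : B, ℓ (L₀ v) = ℓ v)
    (hmass : ∀ (i : ℕ) (v : B), ℓ (L i v) = ℓ v)
    (lam₁ B₀ : ℝ) (hlam : lam₁ ∈ Set.Ioo (0 : ℝ) 1) (hB₀ : 0 < B₀)
    -- (ML1) common one-step Lasota–Yorke inequalities
    (hLY₀w : ∀ f : B, nw (L₀ f) ≤ nw f)
    (hLY₀s : ∀ f : B, ‖L₀ f‖ ≤ lam₁ * ‖f‖ + B₀ * nw f)
    (hLYw : ∀ (i : ℕ) (f : B), nw (L i f) ≤ nw f)
    (hLYs : ∀ (i : ℕ) (f : B), ‖L i f‖ ≤ lam₁ * ‖f‖ + B₀ * nw f)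
    -- (ML2)
    (M : ℕ) (hM1 : 1 ≤ M)
    (hMpow : lam₁ ^ M ≤ 1 / (10 * (B₀ / (1 - lam₁) + 1)))
    (hMweak : ∀ v ∈ LinearMap.ker ℓ, nw ((L₀ ^ M) v) ≤ ((1 - lam₁) / (10 * B₀)) * ‖v‖)
    -- (ML3)
    (hclose : ∀ (i : ℕ) (v : B),
      nw (L i v - L₀ v) ≤ (7 * (1 - lam₁) ^ 2 / (10 * M * B₀ * (1 / (1 - lam₁) + B₀))) * ‖v‖) :
    ∃ C : ℝ, 0 ≤ C ∧ ∃ lam : ℝ, 0 < lam ∧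
      ∀ (j n : ℕ), ∀ g ∈ LinearMap.ker ℓ,
        ‖fwdComp L j n g‖ ≤ C * Real.exp (-lam * n) * ‖g‖ := by
  obtain ⟨hl0, hl1⟩ := hlam
  have ha : 0 < 1 - lam₁ := sub_pos.2 hl1
  have hM : (0 : ℝ) < M := by exact_mod_cast hM1
  have hD : 0 < B₀ / (1 - lam₁) := div_pos hB₀ ha
  have hnw_zero : nw 0 = 0 := by simpa using hnw_smul 0 0
  have hLY := fwdComp_norm_le hnw_nonneg ⟨hl0, hl1⟩ hB₀ hLYw hLYs
  have hbound : ∀ (T : ℕ → (B →ₗ[ℝ] B)), (∀ i f, nw (T i f) ≤ nw f) →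
      (∀ i f, ‖T i f‖ ≤ lam₁ * ‖f‖ + B₀ * nw f) → ∀ (j n : ℕ) (v : B),
      ‖fwdComp T j n v‖ ≤ (1 + B₀ / (1 - lam₁)) * ‖v‖ := by
    intro T hw hs j n v
    have h1 := fwdComp_norm_le hnw_nonneg ⟨hl0, hl1⟩ hB₀ hw hs j n v
    have h2 := mul_le_mul_of_nonneg_right (pow_le_one₀ (n := n) hl0.le hl1.le) (norm_nonneg v)
    have h3 := mul_le_mul_of_nonneg_left (hwle v) hD.le
    linarith
  have hweak : ∀ (j : ℕ) (v : B), v ∈ LinearMap.ker ℓ →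
      nw (fwdComp L j M v) ≤ 8 * (1 - lam₁) / (10 * B₀) * ‖v‖ := by
    intro j v hv
    have h1 := fwdComp_sub_pow_weak_le hnw_zero hnw_add hLYw hclose j M v
    have h2 : ∑ k ∈ Finset.range M, ‖(L₀ ^ k) v‖ ≤ M * ((1 + B₀ / (1 - lam₁)) * ‖v‖) := by
      refine (Finset.sum_le_card_nsmul _ _ _ fun k _ => ?_).trans_eq
        (by rw [Finset.card_range, nsmul_eq_mul])
      rw [← fwdComp_const L₀ 0 k]
      exact hbound _ (fun _ => hLY₀w) (fun _ => hLY₀s) 0 k v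
    have h3 : 7 * (1 - lam₁) ^ 2 / (10 * M * B₀ * (1 / (1 - lam₁) + B₀)) *
        (M * (1 + B₀ / (1 - lam₁))) ≤ 7 * (1 - lam₁) / (10 * B₀) := by
      have ha1 : 1 - lam₁ ≤ 1 := by linarith
      generalize 1 - lam₁ = a at *
      have e : 7 * a ^ 2 / (10 * M * B₀ * (1 / a + B₀)) * (M * (1 + B₀ / a))
          = 7 * a / (10 * B₀) * (a * (a + B₀) / (1 + a * B₀)) := by
        field_simp
      rw [e]
      refine mul_le_of_le_one_right (by positivity) ?_
      rw [div_le_one (by positivity)]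
      nlinarith
    have h4 := hnw_add (fwdComp L j M v - (L₀ ^ M) v) ((L₀ ^ M) v)
    rw [sub_add_cancel] at h4
    calc nw (fwdComp L j M v)
        ≤ 7 * (1 - lam₁) ^ 2 / (10 * M * B₀ * (1 / (1 - lam₁) + B₀)) *
            (M * ((1 + B₀ / (1 - lam₁)) * ‖v‖)) + (1 - lam₁) / (10 * B₀) * ‖v‖ :=
          h4.trans (add_le_add (h1.trans (mul_le_mul_of_nonneg_left h2 (by positivity)))
            (hMweak v hv))
      _ = 7 * (1 - lam₁) ^ 2 / (10 * M * B₀ * (1 / (1 - lam₁) + B₀)) *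
            (M * (1 + B₀ / (1 - lam₁))) * ‖v‖ + (1 - lam₁) / (10 * B₀) * ‖v‖ := by ring
      _ ≤ 7 * (1 - lam₁) / (10 * B₀) * ‖v‖ + (1 - lam₁) / (10 * B₀) * ‖v‖ := by gcongr
      _ = _ := by ring
  have hcontr : ∀ (j : ℕ) (v : B), v ∈ LinearMap.ker ℓ →
      ‖fwdComp L j (M + M) v‖ ≤ 9 / 10 * ‖v‖ := by
    intro j v hv
    rw [fwdComp_add]
    have hp : lam₁ ^ M * (1 + B₀ / (1 - lam₁)) ≤ 1 / 10 := by
      rw [le_div_iff₀ (by positivity)] at hMpow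
      linarith
    calc _ ≤ lam₁ ^ M * ‖fwdComp L (j + M) M v‖
            + B₀ / (1 - lam₁) * nw (fwdComp L (j + M) M v) := hLY j M _
      _ ≤ lam₁ ^ M * ((1 + B₀ / (1 - lam₁)) * ‖v‖)
            + B₀ / (1 - lam₁) * (8 * (1 - lam₁) / (10 * B₀) * ‖v‖) := by
          gcongr
          · exact hbound L hLYw hLYs _ _ _
          · exact hweak _ _ hv
      _ = lam₁ ^ M * (1 + B₀ / (1 - lam₁)) * ‖v‖ + 8 / 10 * ‖v‖ := by field_simp
      _ ≤ 1 / 10 * ‖v‖ + 8 / 10 * ‖v‖ := by gcongr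
      _ = _ := by ring
  have hlog : Real.log (9 / 10) < 0 := Real.log_neg (by norm_num) (by norm_num)
  obtain ⟨r, hr, hexp⟩ : ∃ r : ℝ, 0 < r ∧ Real.exp (-r * (M + M)) = 9 / 10 := by
    refine ⟨-Real.log (9 / 10) / (M + M), div_pos (neg_pos.2 hlog) (by positivity), ?_⟩
    rw [← Real.exp_log (show (0 : ℝ) < 9 / 10 by norm_num)]
    congr 1
    rw [Real.exp_log (by norm_num)]
    field_simp
  refine ⟨(1 + B₀ / (1 - lam₁)) * (10 / 9), by positivity, r, hr, fun j n => ?_⟩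
  induction n using Nat.strong_induction_on generalizing j with
  | _ n ih =>
    intro g hg
    rcases lt_or_ge n (M + M) with hn | hn
    · have hn' : (n : ℝ) ≤ M + M := by exact_mod_cast hn.le
      have h1 : 9 / 10 ≤ Real.exp (-r * n) := by
        rw [← hexp, Real.exp_le_exp]
        nlinarith
      have h2 : 1 ≤ 10 / 9 * Real.exp (-r * n) := by linarith
      refine (hbound L hLYw hLYs j n g).trans ?_
      rw [mul_assoc (1 + _)]
      gcongr
      exact le_mul_of_one_le_right (by positivity) h2
    · obtain ⟨m, rfl⟩ := Nat.exists_eq_add_of_le hn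
      rw [fwdComp_add]
      have hmem : fwdComp L (j + (M + M)) m g ∈ LinearMap.ker ℓ :=
        (fwdComp_mass hmass _ _ _).trans hg
      have h1 := hcontr j _ hmem
      have h2 := ih m (by omega) (j + (M + M)) g hg
      have h3 : Real.exp (-r * ((M + M + m : ℕ) : ℝ)) = 9 / 10 * Real.exp (-r * m) := by
        rw [← hexp, ← Real.exp_add]
        push_cast
        ring_nf
      rw [h3]
      linarith
end

section
/- Let (X, 𝒜, m) be a probability measure space, α ∈ (0,1], and let k : X × X → ℝ be measurable with k(x,y) ≥ α for m⊗m-almost every (x,y) and ∫_X k(x,y) dm(y) = 1 for every x ∈ X. Define L on L¹(m) by (L f)(y) := ∫_X f(x) k(x,y) dm(x). Then for every h ∈ L¹(m) with ∫_X h dm = 0, one has ‖L h‖_{L¹(m)} ≤ (1 − α) ‖h‖_{L¹(m)}. -/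
open MeasureTheory

/-- Weighting a kernel of constant mass `c`, almost everywhere nonnegative, by `|h|` multiplies
the integral of `|h|` by `c`. -/
theorem ae_integral_abs_mul_kernel
    {X : Type*} [MeasurableSpace X] {μ : Measure X} [SFinite μ] {c : ℝ} {q : X → X → ℝ}
    (hq_nonneg : ∀ᵐ p ∂(μ.prod μ), 0 ≤ q p.1 p.2) (hq_mass : ∀ x, ∫ y, q x y ∂μ = c)
    (h : X → ℝ) : (fun x => ∫ y, |h x * q x y| ∂μ) =ᵐ[μ] fun x => |h x| * c := by
  filter_upwards [Measure.ae_ae_of_ae_prod hq_nonneg] with x hx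
  rw [← hq_mass x, ← integral_const_mul]
  refine integral_congr_ae ?_
  filter_upwards [hx] with y hy
  rw [abs_mul, abs_of_nonneg hy]

/-- An integrable function weighted by a nonnegative kernel of constant mass is integrable on the
product space. -/
theorem integrable_mul_kernel
    {X : Type*} [MeasurableSpace X] {μ : Measure X} [SFinite μ] {c : ℝ} {q : X → X → ℝ}
    (hq_meas : Measurable (Function.uncurry q)) (hq_int : ∀ x, Integrable (q x) μ)
    (hq_nonneg : ∀ᵐ p ∂(μ.prod μ), 0 ≤ q p.1 p.2) (hq_mass : ∀ x, ∫ y, q x y ∂μ = c)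
    {h : X → ℝ} (hint : Integrable h μ) :
    Integrable (fun p : X × X => h p.1 * q p.1 p.2) (μ.prod μ) := by
  have hmeas : AEStronglyMeasurable (fun p : X × X => h p.1 * q p.1 p.2) (μ.prod μ) :=
    hint.aestronglyMeasurable.comp_fst.mul hq_meas.aestronglyMeasurable
  refine (integrable_prod_iff hmeas).2 ⟨.of_forall fun x => (hq_int x).const_mul (h x), ?_⟩
  exact (hint.abs.mul_const c).congr (ae_integral_abs_mul_kernel hq_nonneg hq_mass h).symm

/-- One-step Doeblin contraction in `L¹`: if the kernel density `k` satisfies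
`k(x,y) ≥ α > 0` for `μ⊗μ`-a.e. `(x,y)` and `∫ k(x,·) dμ = 1` for every `x`, then
the transfer operator `(L h)(y) = ∫ h(x) k(x,y) dμ(x)` contracts the `L¹` norm of every
zero-mean `h` by the factor `1 − α`. -/
theorem doeblin_one_step_contraction
    {X : Type*} [MeasurableSpace X] (μ : Measure X) [IsProbabilityMeasure μ]
    (α : ℝ) (hα : α ∈ Set.Ioc (0 : ℝ) 1)
    (k : X → X → ℝ)
    (hkmeas : Measurable (Function.uncurry k))
    (hkpos : ∀ᵐ p ∂(μ.prod μ), α ≤ k p.1 p.2)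
    (hkmarkov : ∀ x : X, ∫ y, k x y ∂μ = 1)
    (h : X → ℝ) (hint : Integrable h μ) (hzero : (∫ x, h x ∂μ) = 0) :
    ∫ y, |∫ x, h x * k x y ∂μ| ∂μ ≤ (1 - α) * ∫ x, |h x| ∂μ := by
  have hk_int (x : X) : Integrable (k x) μ :=
    Integrable.of_integral_ne_zero (by simp [hkmarkov x])
  have hq_int (x : X) : Integrable (fun y => k x y - α) μ := (hk_int x).sub (integrable_const α)
  have hq_nonneg : ∀ᵐ p ∂(μ.prod μ), 0 ≤ k p.1 p.2 - α := by
    filter_upwards [hkpos] with p hp using sub_nonneg.2 hp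
  have hq_mass (x : X) : ∫ y, (k x y - α) ∂μ = 1 - α := by
    simp [integral_sub (hk_int x) (integrable_const α), hkmarkov x]
  have hF : Integrable (fun p : X × X => h p.1 * (k p.1 p.2 - α)) (μ.prod μ) :=
    integrable_mul_kernel (hkmeas.sub_const α) hq_int hq_nonneg hq_mass hint
  have hsub : ∀ᵐ y ∂μ, ∫ x, h x * k x y ∂μ = ∫ x, h x * (k x y - α) ∂μ := by
    filter_upwards [hF.prod_left_ae] with y hy
    calc ∫ x, h x * k x y ∂μ = ∫ x, (h x * (k x y - α) + h x * α) ∂μ := by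
          congr with x; ring
      _ = ∫ x, h x * (k x y - α) ∂μ := by
          rw [integral_add hy (hint.mul_const α), integral_mul_const, hzero, zero_mul, add_zero]
  calc ∫ y, |∫ x, h x * k x y ∂μ| ∂μ
      = ∫ y, |∫ x, h x * (k x y - α) ∂μ| ∂μ :=
        integral_congr_ae (hsub.mono fun y hy => congrArg abs hy)
    _ ≤ ∫ y, ∫ x, |h x * (k x y - α)| ∂μ ∂μ :=
        integral_mono hF.integral_prod_right.abs hF.abs.integral_prod_right
          fun y => abs_integral_le_integral_abs
    _ = ∫ x, ∫ y, |h x * (k x y - α)| ∂μ ∂μ := (integral_integral_swap hF.abs).symm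
    _ = ∫ x, |h x| * (1 - α) ∂μ :=
        integral_congr_ae (ae_integral_abs_mul_kernel hq_nonneg hq_mass h)
    _ = (1 - α) * ∫ x, |h x| ∂μ := by rw [integral_mul_const, mul_comm]
end

section
/- Let λ₀ ≥ 1, M₂ ≥ 0, δ ≥ 0. Let T₀ : ℝ → ℝ be twice continuously differentiable with |T₀'(x)| ≥ λ₀ and |T₀''(x)| ≤ M₂ for all x, and let T₁ : ℝ → ℝ be differentiable with |T₁'(x)| ≥ 1 for all x. Assume sup_x |T₀(x) − T₁(x)| ≤ δ and sup_x |T₀'(x) − T₁'(x)| ≤ δ. Then whenever y₀, y₁ ∈ ℝ satisfy T₀(y₀) = T₁(y₁), one has | 1/|T₀'(y₀)| − 1/|T₁'(y₁)| | ≤ (M₂/λ₀³ + 1/λ₀) δ. -/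
/-- A lower bound on the modulus of the derivative makes a real function expanding. -/
theorem mul_abs_sub_le_of_le_abs_deriv {f : ℝ → ℝ} {c : ℝ} (hf : Differentiable ℝ f)
    (hc : ∀ x, c ≤ |deriv f x|) (x y : ℝ) : c * |x - y| ≤ |f x - f y| := by
  wlog hxy : y < x generalizing x y
  · rcases (not_lt.mp hxy).eq_or_lt with rfl | h
    · simp
    · rw [abs_sub_comm x, abs_sub_comm (f x)]
      exact this y x h
  obtain ⟨z, -, hz⟩ := exists_deriv_eq_slope f hxy hf.continuous.continuousOn
    hf.differentiableOn
  rw [eq_div_iff (sub_pos.mpr hxy).ne'] at hz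
  rw [← hz, abs_mul]
  exact mul_le_mul_of_nonneg_right (hc z) (abs_nonneg _)

theorem abs_one_div_abs_sub_one_div_abs_le {a b p q : ℝ} (hp : 0 < p) (hq : 0 < q)
    (ha : p ≤ |a|) (hb : q ≤ |b|) : abs (1 / |a| - 1 / |b|) ≤ |a - b| / (p * q) := by
  have ha' : 0 < |a| := hp.trans_le ha
  have hb' : 0 < |b| := hq.trans_le hb
  rw [div_sub_div _ _ ha'.ne' hb'.ne', abs_div, abs_of_pos (mul_pos ha' hb'), one_mul, mul_one,
    abs_sub_comm]
  exact div_le_div₀ (abs_nonneg _) (abs_abs_sub_abs_le a b) (mul_pos hp hq)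
    (mul_le_mul ha hb hq.le ha'.le)

/-- Weight displacement: for nearby expanding maps `T₀` (with `|T₀'| ≥ λ₀ ≥ 1`,
`|T₀''| ≤ M₂`) and `T₁` (with `|T₁'| ≥ 1`), which are `δ`-close in `C¹`,
if `T₀(y₀) = T₁(y₁)` then the Perron–Frobenius weights satisfy
`| 1/|T₀'(y₀)| − 1/|T₁'(y₁)| | ≤ (M₂/λ₀³ + 1/λ₀) δ`. -/
theorem weight_displacement
    (lam₀ M₂ δ : ℝ) (hlam : 1 ≤ lam₀) (hM₂ : 0 ≤ M₂) (hδ : 0 ≤ δ)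
    (T₀ T₁ : ℝ → ℝ)
    (hT₀ : ContDiff ℝ 2 T₀)
    (hT₀' : ∀ x : ℝ, lam₀ ≤ |deriv T₀ x|)
    (hT₀'' : ∀ x : ℝ, |deriv (deriv T₀) x| ≤ M₂)
    (hT₁d : Differentiable ℝ T₁)
    (hT₁' : ∀ x : ℝ, 1 ≤ |deriv T₁ x|)
    (hC0 : ∀ x : ℝ, |T₀ x - T₁ x| ≤ δ)
    (hC1 : ∀ x : ℝ, |deriv T₀ x - deriv T₁ x| ≤ δ)
    (y₀ y₁ : ℝ) (hy : T₀ y₀ = T₁ y₁) :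
    abs (1 / |deriv T₀ y₀| - 1 / |deriv T₁ y₁|) ≤ (M₂ / lam₀ ^ 3 + 1 / lam₀) * δ := by
  have hlam_pos : 0 < lam₀ := by linarith
  have hdisp : |y₀ - y₁| ≤ δ / lam₀ := by
    rw [le_div_iff₀' hlam_pos]
    refine (mul_abs_sub_le_of_le_abs_deriv (hT₀.differentiable two_ne_zero) hT₀' y₀ y₁).trans ?_
    rw [hy, abs_sub_comm]
    exact hC0 y₁
  have hlip : |deriv T₀ y₀ - deriv T₀ y₁| ≤ M₂ * |y₀ - y₁| :=
    Convex.norm_image_sub_le_of_norm_deriv_le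
      (fun x _ => hT₀.differentiable_deriv_two x) (fun x _ => hT₀'' x) convex_univ
      (Set.mem_univ y₁) (Set.mem_univ y₀)
  calc abs (1 / |deriv T₀ y₀| - 1 / |deriv T₁ y₁|)
      ≤ abs (1 / |deriv T₀ y₀| - 1 / |deriv T₀ y₁|)
        + abs (1 / |deriv T₀ y₁| - 1 / |deriv T₁ y₁|) := abs_sub_le _ _ _
    _ ≤ |deriv T₀ y₀ - deriv T₀ y₁| / (lam₀ * lam₀)
        + |deriv T₀ y₁ - deriv T₁ y₁| / (lam₀ * 1) :=
      add_le_add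
        (abs_one_div_abs_sub_one_div_abs_le hlam_pos hlam_pos (hT₀' y₀) (hT₀' y₁))
        (abs_one_div_abs_sub_one_div_abs_le hlam_pos one_pos (hT₀' y₁) (hT₁' y₁))
    _ ≤ M₂ * (δ / lam₀) / (lam₀ * lam₀) + δ / (lam₀ * 1) := by
      gcongr
      · exact hlip.trans (mul_le_mul_of_nonneg_left hdisp hM₂)
      · exact hC1 y₁
    _ = (M₂ / lam₀ ^ 3 + 1 / lam₀) * δ := by
      field_simp
end

section
/- Let F : ℝ → ℝ be continuously differentiable and 1-periodic, let τ : ℝ → ℝ be continuously differentiable with sup_{t∈ℝ} |τ'(t)| ≤ M, and let η₀, η₁ : [0,1] → ℝ be measurable with τ(η₁(x)) = x for all x ∈ [0,1] and Δ := sup_{x∈[0,1]} |η₀(x) − η₁(x)| < ∞. Assume moreover that the union over x ∈ [0,1] of the intervals [min(η₀(x), η₁(x)), max(η₀(x), η₁(x))] is contained in some interval of length at most 1. Then ∫₀¹ |F(η₀(x)) − F(η₁(x))| dx ≤ 2 M Δ ∫₀¹ |F'(t)| dt. -/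
open MeasureTheory Set

theorem enorm_sub_le_lintegral_deriv {F : ℝ → ℝ} (hF : ContDiff ℝ 1 F) (u v : ℝ) :
    ‖F u - F v‖ₑ ≤ ∫⁻ t in uIoc v u, ‖deriv F t‖ₑ := by
  have hint : IntervalIntegrable (deriv F) volume v u :=
    (hF.continuous_deriv le_rfl).intervalIntegrable v u
  rw [← intervalIntegral.integral_deriv_eq_sub
    (fun x _ => hF.differentiable one_ne_zero x) hint, ← ofReal_norm,
    intervalIntegral.norm_integral_eq_norm_integral_uIoc, ofReal_norm]
  exact enorm_integral_le_lintegral_enorm _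

/-- The times whose displacement interval contains `t` lie within `M * Δ` of `τ t`. -/
theorem volume_setOf_mem_uIoc_le {τ : ℝ → ℝ} (hτ : ContDiff ℝ 1 τ)
    {M : ℝ} (hM : ∀ t, |deriv τ t| ≤ M) {η₀ η₁ : ℝ → ℝ} {s : Set ℝ}
    (hinv : ∀ x ∈ s, τ (η₁ x) = x) {Δ : ℝ} (hΔ : ∀ x ∈ s, |η₀ x - η₁ x| ≤ Δ) (t : ℝ) :
    volume {x ∈ s | t ∈ uIoc (η₁ x) (η₀ x)} ≤ ENNReal.ofReal (2 * M * Δ) := by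
  have hM0 : 0 ≤ M := (abs_nonneg _).trans (hM 0)
  have hsub : {x ∈ s | t ∈ uIoc (η₁ x) (η₀ x)} ⊆ Icc (τ t - M * Δ) (τ t + M * Δ) := by
    rintro x ⟨hx, ht⟩
    have hlip : |τ (η₁ x) - τ t| ≤ M * |η₁ x - t| :=
      convex_univ.norm_image_sub_le_of_norm_deriv_le
        (fun y _ => hτ.differentiable one_ne_zero y) (fun y _ => hM y) (mem_univ t)
        (mem_univ (η₁ x))
    have hdist : |η₁ x - t| ≤ Δ := by
      rw [abs_sub_comm]
      exact (abs_sub_left_of_mem_uIcc (uIoc_subset_uIcc ht)).trans (hΔ x hx)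
    rw [hinv x hx] at hlip
    have := abs_le.1 (hlip.trans (mul_le_mul_of_nonneg_left hdist hM0))
    constructor <;> linarith
  calc volume {x ∈ s | t ∈ uIoc (η₁ x) (η₀ x)}
      ≤ volume (Icc (τ t - M * Δ) (τ t + M * Δ)) := measure_mono hsub
    _ = ENNReal.ofReal (2 * M * Δ) := by rw [Real.volume_Icc]; ring_nf

theorem measurableSet_setOf_mem_uIoc {η₀ η₁ : ℝ → ℝ} (h₀ : Measurable η₀) (h₁ : Measurable η₁) :
    MeasurableSet {p : ℝ × ℝ | p.2 ∈ uIoc (η₁ p.1) (η₀ p.1)} := by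
  have h₀' : Measurable fun p : ℝ × ℝ => η₀ p.1 := h₀.comp measurable_fst
  have h₁' : Measurable fun p : ℝ × ℝ => η₁ p.1 := h₁.comp measurable_fst
  exact (measurableSet_lt (h₁'.min h₀') measurable_snd).inter
    (measurableSet_le measurable_snd (h₁'.max h₀'))

/-- Tonelli: if every `t` belongs to the displacement intervals of a set of `x` of measure at
most `C`, the displacement of `F` is at most `C` times the variation of `F` over a set containing
all these intervals. -/
theorem lintegral_enorm_comp_sub_comp_le {F : ℝ → ℝ} (hF : ContDiff ℝ 1 F)
    {η₀ η₁ : ℝ → ℝ} (h₀ : Measurable η₀) (h₁ : Measurable η₁) {s I : Set ℝ}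
    (hs : MeasurableSet s) (hI : ∀ x ∈ s, uIoc (η₁ x) (η₀ x) ⊆ I) {C : ENNReal}
    (hC : ∀ t, volume {x ∈ s | t ∈ uIoc (η₁ x) (η₀ x)} ≤ C) :
    ∫⁻ x in s, ‖F (η₀ x) - F (η₁ x)‖ₑ ≤ C * ∫⁻ t in I, ‖deriv F t‖ₑ := by
  have hF' : Measurable fun t => ‖deriv F t‖ₑ := (measurable_deriv F).enorm
  have hS := measurableSet_setOf_mem_uIoc h₀ h₁
  set S : Set (ℝ × ℝ) := {p | p.2 ∈ uIoc (η₁ p.1) (η₀ p.1)}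
  calc ∫⁻ x in s, ‖F (η₀ x) - F (η₁ x)‖ₑ
      ≤ ∫⁻ x in s, ∫⁻ t in I, S.indicator (fun p => ‖deriv F p.2‖ₑ) (x, t) := by
        refine setLIntegral_mono' hs fun x hx => (enorm_sub_le_lintegral_deriv hF _ _).trans ?_
        rw [← inter_eq_left.2 (hI x hx), ← Measure.restrict_restrict measurableSet_uIoc,
          ← lintegral_indicator measurableSet_uIoc]
        exact le_rfl
    _ = ∫⁻ t in I, ∫⁻ x in s, S.indicator (fun p => ‖deriv F p.2‖ₑ) (x, t) :=
        lintegral_lintegral_swap ((hF'.comp measurable_snd).indicator hS).aemeasurable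
    _ ≤ ∫⁻ t in I, C * ‖deriv F t‖ₑ := by
        refine lintegral_mono fun t => ?_
        have hSt : MeasurableSet {x | (x, t) ∈ S} := measurable_prodMk_right hS
        calc ∫⁻ x in s, S.indicator (fun p => ‖deriv F p.2‖ₑ) (x, t)
            = ∫⁻ x in s, {x | (x, t) ∈ S}.indicator (fun _ => ‖deriv F t‖ₑ) x := rfl
          _ = ‖deriv F t‖ₑ * volume {x ∈ s | t ∈ uIoc (η₁ x) (η₀ x)} := by
              rw [lintegral_indicator_const hSt, Measure.restrict_apply hSt, inter_comm]
              rfl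
          _ ≤ C * ‖deriv F t‖ₑ := by rw [mul_comm]; gcongr; exact hC t
    _ = C * ∫⁻ t in I, ‖deriv F t‖ₑ := lintegral_const_mul _ hF'


/-- Composition displacement in `L¹`: if `F` is `C¹` and 1-periodic, `τ` is `C¹` with
`|τ'| ≤ M`, `η₁` is a right inverse of `τ` on `[0,1]`, `η₀` is uniformly `Δ`-close to
`η₁` on `[0,1]`, and all the displacement intervals `[min(η₀ x, η₁ x), max(η₀ x, η₁ x)]`
for `x ∈ [0,1]` are contained in a single interval of length at most `1`, then
`∫₀¹ |F(η₀ x) − F(η₁ x)| dx ≤ 2 M Δ ∫₀¹ |F'|`. -/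
theorem composition_displacement
    (F : ℝ → ℝ) (hF : ContDiff ℝ 1 F) (hFper : ∀ x : ℝ, F (x + 1) = F x)
    (τ : ℝ → ℝ) (hτ : ContDiff ℝ 1 τ)
    (M : ℝ) (hM : ∀ t : ℝ, |deriv τ t| ≤ M)
    (η₀ η₁ : ℝ → ℝ) (hη₀m : Measurable η₀) (hη₁m : Measurable η₁)
    (hη₁inv : ∀ x ∈ Set.Icc (0 : ℝ) 1, τ (η₁ x) = x)
    (Δ : ℝ) (hΔ : ∀ x ∈ Set.Icc (0 : ℝ) 1, |η₀ x - η₁ x| ≤ Δ)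
    (hfund : ∃ a b : ℝ, b - a ≤ 1 ∧
      ∀ x ∈ Set.Icc (0 : ℝ) 1, Set.uIcc (η₀ x) (η₁ x) ⊆ Set.Icc a b) :
    (∫ x in (0 : ℝ)..1, |F (η₀ x) - F (η₁ x)|) ≤
      2 * M * Δ * ∫ t in (0 : ℝ)..1, |deriv F t| := by
  obtain ⟨a, b, hab, hsub⟩ := hfund
  have hIcc : ∀ x ∈ Ioc (0 : ℝ) 1, x ∈ Icc (0 : ℝ) 1 := fun _ hx => Ioc_subset_Icc_self hx
  have hMΔ : 0 ≤ 2 * M * Δ :=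
    mul_nonneg (mul_nonneg zero_le_two ((abs_nonneg _).trans (hM 0)))
      ((abs_nonneg _).trans (hΔ 0 (by simp)))
  have hI : ∀ x ∈ Ioc (0 : ℝ) 1, uIoc (η₁ x) (η₀ x) ⊆ Ioc a (a + 1) := by
    intro x hx
    have h₀ := hsub x (hIcc x hx) left_mem_uIcc
    have h₁ := hsub x (hIcc x hx) right_mem_uIcc
    exact Ioc_subset_Ioc (le_min h₁.1 h₀.1) (max_le (by linarith [h₁.2]) (by linarith [h₀.2]))
  have hkey := lintegral_enorm_comp_sub_comp_le hF hη₀m hη₁m measurableSet_Ioc hI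
    (volume_setOf_mem_uIoc_le hτ hM (fun x hx => hη₁inv x (hIcc x hx))
      (fun x hx => hΔ x (hIcc x hx)))
  have hcont : Continuous (deriv F) := hF.continuous_deriv le_rfl
  have hper : Function.Periodic (fun t => |deriv F t|) 1 := by
    intro t
    dsimp only
    rw [← deriv_comp_add_const, funext hFper]
  have hshift : ∫ t in (0 : ℝ)..1, |deriv F t| = ∫ t in Ioc a (a + 1), ‖deriv F t‖ := by
    rw [← intervalIntegral.integral_of_le (by linarith)]
    simpa using hper.intervalIntegral_add_eq 0 a
  have hint : Integrable (deriv F) (volume.restrict (Ioc a (a + 1))) :=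
    hcont.integrableOn_Ioc
  have hmeas : Measurable fun x => F (η₀ x) - F (η₁ x) :=
    (hF.continuous.measurable.comp hη₀m).sub (hF.continuous.measurable.comp hη₁m)
  rw [hshift, intervalIntegral.integral_of_le zero_le_one]
  simp only [← Real.norm_eq_abs]
  rw [integral_norm_eq_lintegral_enorm hmeas.aestronglyMeasurable]
  refine ENNReal.toReal_le_of_le_ofReal
    (mul_nonneg hMΔ (integral_nonneg fun _ => norm_nonneg _)) ?_
  rwa [ENNReal.ofReal_mul hMΔ, ofReal_integral_norm_eq_lintegral_enorm hint]
end

section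
/- Let n ≥ 2 be an integer, λ₀ > 1, M₀ = sup |τ₀'|, M₂ = sup |τ₀''|. Let τ₀, τ₁ : ℝ → ℝ be twice continuously differentiable with τ_i(x+1) = τ_i(x) + n for all x, τ₀'(x) ≥ λ₀ and τ₁'(x) ≥ 1 for all x. Let δ := max( sup_x |τ₀(x) − τ₁(x)|, sup_x |τ₀'(x) − τ₁'(x)|, sup_x |τ₀''(x) − τ₁''(x)| ) and assume δ ≤ λ₀ − 1. Let σ_i : ℝ → ℝ be the global inverse of the strictly increasing bijection τ_i, and define, for 1-periodic f : ℝ → ℝ, the Perron–Frobenius operator (L_i f)(x) := Σ_{j=0}^{n−1} f(σ_i(x + j)) · σ_i'(x + j). Then for every continuously differentiable 1-periodic f : ℝ → ℝ, ∫₀¹ |(L₀ f)(x) − (L₁ f)(x)| dx ≤ C(τ₀) · ( ∫₀¹ |f| + ∫₀¹ |f'| ) · δ, where C(τ₀) := n [ 2 (M₀ + λ₀ − 1)/λ₀² + (M₀ + λ₀ − 1)(M₂/λ₀³ + 1/λ₀) ]. -/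
open MeasureTheory intervalIntegral

lemma continuous_of_rightInverse_of_deriv_pos {τ σ : ℝ → ℝ} (hpos : ∀ x, 0 < deriv τ x)
    (hr : ∀ x, τ (σ x) = x) : Continuous σ :=
  ((strictMono_of_deriv_pos hpos).orderIsoOfRightInverse τ σ hr).symm.continuous

lemma hasDerivAt_of_rightInverse {τ σ : ℝ → ℝ} (hτ : Differentiable ℝ τ)
    (hpos : ∀ x, 0 < deriv τ x) (hr : ∀ x, τ (σ x) = x) (x : ℝ) :
    HasDerivAt σ (deriv τ (σ x))⁻¹ x :=
  (hτ (σ x)).hasDerivAt.of_local_left_inverse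
    (continuous_of_rightInverse_of_deriv_pos hpos hr).continuousAt (hpos _).ne'
    (Filter.Eventually.of_forall hr)

lemma deriv_of_rightInverse {τ σ : ℝ → ℝ} (hτ : Differentiable ℝ τ)
    (hpos : ∀ x, 0 < deriv τ x) (hr : ∀ x, τ (σ x) = x) (x : ℝ) :
    deriv σ x = (deriv τ (σ x))⁻¹ :=
  (hasDerivAt_of_rightInverse hτ hpos hr x).deriv

lemma continuous_deriv_of_rightInverse {τ σ : ℝ → ℝ} (hτ : ContDiff ℝ 1 τ)
    (hpos : ∀ x, 0 < deriv τ x) (hr : ∀ x, τ (σ x) = x) : Continuous (deriv σ) := by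
  rw [funext (deriv_of_rightInverse (hτ.differentiable one_ne_zero) hpos hr)]
  exact ((hτ.continuous_deriv le_rfl).comp
    (continuous_of_rightInverse_of_deriv_pos hpos hr)).inv₀ fun x => (hpos _).ne'

/-- The transfer operator of a circle covering preserves integrals over one period. -/
lemma integral_transfer_operator {τ σ g : ℝ → ℝ} {n : ℕ} (hτ : ContDiff ℝ 1 τ)
    (hpos : ∀ x, 0 < deriv τ x) (hcov : ∀ x, τ (x + 1) = τ x + n)
    (hr : ∀ x, τ (σ x) = x) (hl : ∀ x, σ (τ x) = x)
    (hg : Continuous g) (hgper : Function.Periodic g 1) :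
    ∫ x in (0 : ℝ)..1, ∑ j ∈ Finset.range n, g (σ (x + j)) * deriv σ (x + j) =
      ∫ x in (0 : ℝ)..1, g x := by
  have hσ := continuous_of_rightInverse_of_deriv_pos hpos hr
  have hσ' := continuous_deriv_of_rightInverse hτ hpos hr
  have hF : Continuous fun y => g (σ y) * deriv σ y := by fun_prop
  have hσn : σ (n : ℝ) = σ 0 + 1 := by
    rw [← hl (σ 0 + 1), hcov, hr, zero_add]
  calc ∫ x in (0 : ℝ)..1, ∑ j ∈ Finset.range n, g (σ (x + j)) * deriv σ (x + j)
      = ∑ j ∈ Finset.range n, ∫ x in (0 : ℝ)..1, g (σ (x + j)) * deriv σ (x + j) :=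
        integral_finsetSum fun j _ => Continuous.intervalIntegrable (by fun_prop) _ _
    _ = ∑ j ∈ Finset.range n, ∫ y in (j : ℝ)..((j + 1 : ℕ) : ℝ), g (σ y) * deriv σ y := by
        refine Finset.sum_congr rfl fun j _ => ?_
        rw [integral_comp_add_right (fun y => g (σ y) * deriv σ y)]
        push_cast
        rw [zero_add, add_comm]
    _ = ∫ y in (0 : ℝ)..n, g (σ y) * deriv σ y := by
        rw [sum_integral_adjacent_intervals (a := fun j : ℕ => (j : ℝ))
          fun j _ => hF.intervalIntegrable _ _, Nat.cast_zero]
    _ = ∫ x in σ 0..σ n, g x :=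
        integral_comp_mul_deriv
          (fun x _ => (hasDerivAt_of_rightInverse (hτ.differentiable one_ne_zero)
            hpos hr x).differentiableAt.hasDerivAt) hσ'.continuousOn hg
    _ = ∫ x in (0 : ℝ)..1, g x := by
        rw [hσn, hgper.intervalIntegral_add_eq (σ 0) 0, zero_add]

lemma abs_sub_le_integral_abs_deriv {f : ℝ → ℝ} (hf : ContDiff ℝ 1 f) {r x y : ℝ}
    (hxy : |y - x| ≤ r) : |f x - f y| ≤ ∫ t in -r..r, |deriv f (x + t)| := by
  have hc : Continuous (deriv f) := hf.continuous_deriv le_rfl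
  obtain ⟨h1, h2⟩ := abs_le.mp hxy
  have hr : 0 ≤ r := (abs_nonneg _).trans hxy
  have hftc : f y - f x = ∫ u in x..y, deriv f u :=
    (integral_deriv_eq_sub (fun u _ => hf.differentiable one_ne_zero u)
      (hc.intervalIntegrable _ _)).symm
  rw [abs_sub_comm, hftc, integral_comp_add_left (fun u => |deriv f u|) x]
  calc |∫ u in x..y, deriv f u| ≤ |∫ u in x..y, (|deriv f u|)| :=
        norm_integral_le_abs_integral_norm (f := deriv f)
    _ ≤ |∫ u in (x + -r)..(x + r), (|deriv f u|)| := by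
        refine abs_integral_mono_interval ?_ (Filter.Eventually.of_forall fun u => abs_nonneg _)
          (hc.abs.intervalIntegrable _ _)
        rw [Set.uIoc_of_le (by linarith : x + -r ≤ x + r)]
        rintro u ⟨hu1, hu2⟩
        refine ⟨lt_of_le_of_lt (le_min ?_ ?_) hu1, hu2.trans (max_le ?_ ?_)⟩ <;> linarith
    _ = ∫ u in (x + -r)..(x + r), |deriv f u| :=
        abs_of_nonneg (integral_nonneg (by linarith) fun u _ => abs_nonneg _)

lemma Function.Periodic.integral_integral_add {g : ℝ → ℝ} (hg : Continuous g)
    (hper : Function.Periodic g 1) (r : ℝ) :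
    ∫ x in (0 : ℝ)..1, ∫ t in -r..r, g (x + t) = 2 * r * ∫ x in (0 : ℝ)..1, g x := by
  have hint : IntegrableOn (Function.uncurry fun x t : ℝ => g (x + t))
      (Set.uIoc 0 1 ×ˢ Set.uIoc (-r) r) :=
    ((by fun_prop : Continuous (Function.uncurry fun x t : ℝ => g (x + t))).continuousOn
      |>.integrableOn_compact (isCompact_uIcc.prod isCompact_uIcc)).mono_set
        (Set.prod_mono Set.uIoc_subset_uIcc Set.uIoc_subset_uIcc)
  rw [intervalIntegral_intervalIntegral_swap hint]
  have h (t : ℝ) : ∫ x in (0 : ℝ)..1, g (x + t) = ∫ x in (0 : ℝ)..1, g x := by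
    rw [integral_comp_add_right g, zero_add, add_comm, hper.intervalIntegral_add_eq t 0, zero_add]
  simp_rw [h]
  rw [intervalIntegral.integral_const, smul_eq_mul]
  ring

lemma mul_abs_sub_le_of_le_deriv {τ : ℝ → ℝ} {c : ℝ} (hτ : Differentiable ℝ τ)
    (hc : ∀ x, c ≤ deriv τ x) (a b : ℝ) : c * |a - b| ≤ |τ a - τ b| := by
  wlog hab : b ≤ a generalizing a b
  · rw [abs_sub_comm a, abs_sub_comm (τ a)]
    exact this b a (le_of_not_ge hab)
  rw [abs_of_nonneg (sub_nonneg.mpr hab)]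
  exact (mul_sub_le_image_sub_of_le_deriv hτ hc hab).trans (le_abs_self _)

/-- Inverses of `δ`-close maps are `δ / c`-close, where `c` bounds the derivative below. -/
lemma abs_inverse_sub_le {τ₀ τ₁ σ₀ σ₁ : ℝ → ℝ} {c δ : ℝ} (hc0 : 0 < c)
    (hτ₀ : Differentiable ℝ τ₀) (hc : ∀ x, c ≤ deriv τ₀ x) (hδ : ∀ x, |τ₀ x - τ₁ x| ≤ δ)
    (hr₀ : ∀ x, τ₀ (σ₀ x) = x) (hr₁ : ∀ x, τ₁ (σ₁ x) = x) (y : ℝ) :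
    |σ₁ y - σ₀ y| ≤ δ / c := by
  rw [le_div_iff₀' hc0]
  refine (mul_abs_sub_le_of_le_deriv hτ₀ hc _ _).trans ?_
  simpa [hr₀, hr₁] using hδ (σ₁ y)

/-- The derivatives of the inverses of `C¹`-close maps are close, relative to `deriv σ₁`. -/
lemma abs_deriv_inverse_sub_le {τ₀ τ₁ σ₀ σ₁ : ℝ → ℝ} {c M δ : ℝ} (hc0 : 0 < c)
    (hτ₀ : ContDiff ℝ 2 τ₀) (hτ₁ : Differentiable ℝ τ₁)
    (hc : ∀ x, c ≤ deriv τ₀ x) (hpos₁ : ∀ x, 0 < deriv τ₁ x)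
    (hM : ∀ x, |deriv (deriv τ₀) x| ≤ M) (hδ0 : ∀ x, |τ₀ x - τ₁ x| ≤ δ)
    (hδ1 : ∀ x, |deriv τ₀ x - deriv τ₁ x| ≤ δ)
    (hr₀ : ∀ x, τ₀ (σ₀ x) = x) (hr₁ : ∀ x, τ₁ (σ₁ x) = x) (y : ℝ) :
    |deriv σ₀ y - deriv σ₁ y| ≤ (δ * (1 / c + M / c ^ 2)) * deriv σ₁ y := by
  have hpos₀ (x : ℝ) : 0 < deriv τ₀ x := hc0.trans_le (hc x)
  have hd₀ : Differentiable ℝ τ₀ := hτ₀.differentiable two_ne_zero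
  have hd₀' : Differentiable ℝ (deriv τ₀) := by
    rw [← one_add_one_eq_two] at hτ₀
    exact (contDiff_succ_iff_deriv.mp hτ₀).2.2.differentiable one_ne_zero
  have hM0 : 0 ≤ M := (abs_nonneg _).trans (hM 0)
  have hlip : |deriv τ₀ (σ₁ y) - deriv τ₀ (σ₀ y)| ≤ M * |σ₁ y - σ₀ y| :=
    convex_univ.norm_image_sub_le_of_norm_deriv_le (fun x _ => hd₀' x) (fun x _ => hM x)
      (Set.mem_univ _) (Set.mem_univ _)
  have hnum : |deriv τ₁ (σ₁ y) - deriv τ₀ (σ₀ y)| ≤ δ + M * (δ / c) := by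
    have h1 := abs_sub_le (deriv τ₁ (σ₁ y)) (deriv τ₀ (σ₁ y)) (deriv τ₀ (σ₀ y))
    have h2 := hδ1 (σ₁ y)
    rw [abs_sub_comm] at h2
    have h3 := mul_le_mul_of_nonneg_left
      (abs_inverse_sub_le hc0 hd₀ hc hδ0 hr₀ hr₁ y) hM0
    linarith
  rw [deriv_of_rightInverse hd₀ hpos₀ hr₀, deriv_of_rightInverse hτ₁ hpos₁ hr₁]
  have p₀ := hpos₀ (σ₀ y)
  have p₁ := hpos₁ (σ₁ y)
  rw [inv_sub_inv p₀.ne' p₁.ne', abs_div, abs_of_pos (mul_pos p₀ p₁), div_mul_eq_div_div,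
    div_eq_mul_inv]
  refine mul_le_mul_of_nonneg_right ?_ (inv_pos.mpr p₁).le
  calc _ ≤ (δ + M * (δ / c)) / c :=
        div_le_div₀ ((abs_nonneg _).trans hnum) hnum hc0 (hc _)
    _ = δ * (1 / c + M / c ^ 2) := by field_simp

/-- Sharper form of the mixed continuity estimate, without the factor `n`. -/
lemma integral_abs_transfer_sub_le {n : ℕ} {c M δ : ℝ} {τ₀ τ₁ σ₀ σ₁ f : ℝ → ℝ} (hc0 : 0 < c)
    (hτ₀ : ContDiff ℝ 2 τ₀) (hτ₁ : ContDiff ℝ 2 τ₁)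
    (hcov₀ : ∀ x, τ₀ (x + 1) = τ₀ x + n) (hcov₁ : ∀ x, τ₁ (x + 1) = τ₁ x + n)
    (hc : ∀ x, c ≤ deriv τ₀ x) (hpos₁ : ∀ x, 0 < deriv τ₁ x)
    (hM : ∀ x, |deriv (deriv τ₀) x| ≤ M) (hδ0 : ∀ x, |τ₀ x - τ₁ x| ≤ δ)
    (hδ1 : ∀ x, |deriv τ₀ x - deriv τ₁ x| ≤ δ)
    (hr₀ : ∀ x, τ₀ (σ₀ x) = x) (hl₀ : ∀ x, σ₀ (τ₀ x) = x)
    (hr₁ : ∀ x, τ₁ (σ₁ x) = x) (hl₁ : ∀ x, σ₁ (τ₁ x) = x)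
    (hf : ContDiff ℝ 1 f) (hfper : Function.Periodic f 1) :
    (∫ x in (0 : ℝ)..1,
        |(∑ j ∈ Finset.range n, f (σ₀ (x + j)) * deriv σ₀ (x + j)) -
         (∑ j ∈ Finset.range n, f (σ₁ (x + j)) * deriv σ₁ (x + j))|) ≤
      2 * (δ / c) * (∫ x in (0 : ℝ)..1, |deriv f x|) +
        (δ * (1 / c + M / c ^ 2)) * ∫ x in (0 : ℝ)..1, |f x| := by
  have hpos₀ (x : ℝ) : 0 < deriv τ₀ x := hc0.trans_le (hc x)
  have hC₀ : ContDiff ℝ 1 τ₀ := hτ₀.of_le one_le_two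
  have hC₁ : ContDiff ℝ 1 τ₁ := hτ₁.of_le one_le_two
  have hd₀ : Differentiable ℝ τ₀ := hC₀.differentiable one_ne_zero
  have hd₁ : Differentiable ℝ τ₁ := hC₁.differentiable one_ne_zero
  have hσ₀ := continuous_of_rightInverse_of_deriv_pos hpos₀ hr₀
  have hσ₁ := continuous_of_rightInverse_of_deriv_pos hpos₁ hr₁
  have hσ₀' := continuous_deriv_of_rightInverse hC₀ hpos₀ hr₀
  have hσ₁' := continuous_deriv_of_rightInverse hC₁ hpos₁ hr₁
  have hfc : Continuous f := hf.continuous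
  have hf' : Continuous (deriv f) := hf.continuous_deriv le_rfl
  have hf'per : Function.Periodic (deriv f) 1 := fun x => by
    rw [← deriv_comp_add_const, funext hfper]
  set K := δ * (1 / c + M / c ^ 2) with hK
  set H : ℝ → ℝ := fun x => ∫ t in -(δ / c)..(δ / c), |deriv f (x + t)| with hH
  have hHc : Continuous H :=
    continuous_parametric_intervalIntegral_of_continuous' (by fun_prop) _ _
  have hHper : Function.Periodic H 1 := fun x => by
    simp only [hH, add_right_comm x 1, hf'per _]
  have hpt (y : ℝ) : |f (σ₀ y) * deriv σ₀ y - f (σ₁ y) * deriv σ₁ y| ≤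
      H (σ₀ y) * deriv σ₀ y + K * (|f (σ₁ y)| * deriv σ₁ y) := by
    have hp : 0 ≤ deriv σ₀ y := by
      rw [deriv_of_rightInverse hd₀ hpos₀ hr₀]
      exact (inv_pos.mpr (hpos₀ _)).le
    calc _ = |(f (σ₀ y) - f (σ₁ y)) * deriv σ₀ y
            + f (σ₁ y) * (deriv σ₀ y - deriv σ₁ y)| := by ring_nf
      _ ≤ |f (σ₀ y) - f (σ₁ y)| * deriv σ₀ y
            + |f (σ₁ y)| * |deriv σ₀ y - deriv σ₁ y| := by
          refine (abs_add_le _ _).trans_eq ?_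
          rw [abs_mul, abs_mul, abs_of_nonneg hp]
      _ ≤ H (σ₀ y) * deriv σ₀ y + |f (σ₁ y)| * (K * deriv σ₁ y) := by
          gcongr
          · exact abs_sub_le_integral_abs_deriv hf
              (abs_inverse_sub_le hc0 hd₀ hc hδ0 hr₀ hr₁ y)
          · exact abs_deriv_inverse_sub_le hc0 hτ₀ hd₁ hc hpos₁ hM hδ0 hδ1 hr₀ hr₁ y
      _ = _ := by ring
  have hfabs : Function.Periodic (fun x => |f x|) 1 := fun x => by simp only [hfper x]
  have hf'abs : Function.Periodic (fun x => |deriv f x|) 1 := fun x => by simp only [hf'per x]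
  calc _ ≤ ∫ x in (0 : ℝ)..1, ((∑ j ∈ Finset.range n, H (σ₀ (x + j)) * deriv σ₀ (x + j)) +
          K * ∑ j ∈ Finset.range n, |f (σ₁ (x + j))| * deriv σ₁ (x + j)) := by
        refine integral_mono_on zero_le_one (Continuous.intervalIntegrable (by fun_prop) _ _)
          (Continuous.intervalIntegrable (by fun_prop) _ _) fun x _ => ?_
        rw [← Finset.sum_sub_distrib, Finset.mul_sum, ← Finset.sum_add_distrib]
        exact (Finset.abs_sum_le_sum_abs _ _).trans (Finset.sum_le_sum fun j _ => hpt _)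
    _ = (∫ x in (0 : ℝ)..1, H x) + K * ∫ x in (0 : ℝ)..1, |f x| := by
        rw [integral_add (Continuous.intervalIntegrable (by fun_prop) _ _)
          (Continuous.intervalIntegrable (by fun_prop) _ _), intervalIntegral.integral_const_mul,
          integral_transfer_operator hC₀ hpos₀ hcov₀ hr₀ hl₀ hHc hHper,
          integral_transfer_operator hC₁ hpos₁ hcov₁ hr₁ hl₁ hfc.abs hfabs]
    _ = _ := by rw [hH, hf'abs.integral_integral_add hf'.abs]


/-- Mixed continuity `W^{1,1} → L¹` of Perron–Frobenius operators of nearby uniformly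
expanding circle coverings of degree `n ≥ 2`, expressed through lifts: if `τ₀, τ₁` are
`C²` lifts with `τ_i(x+1) = τ_i(x) + n`, `τ₀' ≥ λ₀ > 1`, `τ₁' ≥ 1`, `τ₀' ≤ M₀`,
`|τ₀''| ≤ M₂`, and `τ₀, τ₁` are `δ`-close in `C²` with `δ ≤ λ₀ − 1`, letting `σ_i`
be the global inverse of `τ_i` and `(L_i f)(x) = Σ_{j<n} f(σ_i(x+j)) σ_i'(x+j)`, then
`∫₀¹ |L₀f − L₁f| ≤ C(τ₀) (∫₀¹|f| + ∫₀¹|f'|) δ` with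
`C(τ₀) = n [2(M₀+λ₀−1)/λ₀² + (M₀+λ₀−1)(M₂/λ₀³ + 1/λ₀)]`. -/
theorem mixed_continuity_expanding_maps
    (n : ℕ) (hn : 2 ≤ n) (lam₀ M₀ M₂ δ : ℝ) (hlam : 1 < lam₀)
    (τ₀ τ₁ : ℝ → ℝ)
    (hτ₀ : ContDiff ℝ 2 τ₀) (hτ₁ : ContDiff ℝ 2 τ₁)
    (hcov₀ : ∀ x : ℝ, τ₀ (x + 1) = τ₀ x + n)
    (hcov₁ : ∀ x : ℝ, τ₁ (x + 1) = τ₁ x + n)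
    (hτ₀' : ∀ x : ℝ, lam₀ ≤ deriv τ₀ x)
    (hτ₁' : ∀ x : ℝ, 1 ≤ deriv τ₁ x)
    (hM₀ : ∀ x : ℝ, deriv τ₀ x ≤ M₀)
    (hM₂ : ∀ x : ℝ, |deriv (deriv τ₀) x| ≤ M₂)
    (hδ0 : ∀ x : ℝ, |τ₀ x - τ₁ x| ≤ δ)
    (hδ1 : ∀ x : ℝ, |deriv τ₀ x - deriv τ₁ x| ≤ δ)
    (hδ2 : ∀ x : ℝ, |deriv (deriv τ₀) x - deriv (deriv τ₁) x| ≤ δ)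
    (hδsmall : δ ≤ lam₀ - 1)
    (σ₀ σ₁ : ℝ → ℝ)
    (hσ₀r : ∀ x : ℝ, τ₀ (σ₀ x) = x) (hσ₀l : ∀ x : ℝ, σ₀ (τ₀ x) = x)
    (hσ₁r : ∀ x : ℝ, τ₁ (σ₁ x) = x) (hσ₁l : ∀ x : ℝ, σ₁ (τ₁ x) = x)
    (f : ℝ → ℝ) (hf : ContDiff ℝ 1 f) (hfper : ∀ x : ℝ, f (x + 1) = f x) :
    (∫ x in (0 : ℝ)..1,
        |(∑ j ∈ Finset.range n, f (σ₀ (x + j)) * deriv σ₀ (x + j)) -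
         (∑ j ∈ Finset.range n, f (σ₁ (x + j)) * deriv σ₁ (x + j))|) ≤
      ((n : ℝ) * (2 * (M₀ + lam₀ - 1) / lam₀ ^ 2 +
        (M₀ + lam₀ - 1) * (M₂ / lam₀ ^ 3 + 1 / lam₀))) *
      ((∫ x in (0 : ℝ)..1, |f x|) + ∫ x in (0 : ℝ)..1, |deriv f x|) * δ := by
  have hl : 0 < lam₀ := one_pos.trans hlam
  have hδ : 0 ≤ δ := (abs_nonneg _).trans (hδ0 0)
  have hM₂0 : 0 ≤ M₂ := (abs_nonneg _).trans (hM₂ 0)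
  have hM₀l : lam₀ ≤ M₀ := (hτ₀' 0).trans (hM₀ 0)
  have hn1 : (1 : ℝ) ≤ n := by exact_mod_cast one_le_two.trans hn
  set A := ∫ x in (0 : ℝ)..1, |f x|
  set B := ∫ x in (0 : ℝ)..1, |deriv f x|
  have hA : 0 ≤ A := integral_nonneg zero_le_one fun x _ => abs_nonneg _
  have hB : 0 ≤ B := integral_nonneg zero_le_one fun x _ => abs_nonneg _
  have hD : lam₀ ≤ M₀ + lam₀ - 1 := by linarith
  have hD1 : 1 ≤ M₀ + lam₀ - 1 := by linarith
  set D := M₀ + lam₀ - 1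
  have hP : 2 / lam₀ ≤ 2 * D / lam₀ ^ 2 := by
    rw [div_le_div_iff₀ hl (by positivity)]
    nlinarith [mul_le_mul_of_nonneg_left hD hl.le]
  have hQ : 1 / lam₀ + M₂ / lam₀ ^ 2 ≤ D * (M₂ / lam₀ ^ 3 + 1 / lam₀) := by
    have h1 : M₂ / lam₀ ^ 2 = lam₀ * (M₂ / lam₀ ^ 3) := by field_simp
    have h2 := mul_le_mul_of_nonneg_right hD (show 0 ≤ M₂ / lam₀ ^ 3 by positivity)
    have h3 := mul_le_mul_of_nonneg_right hD1 (show 0 ≤ 1 / lam₀ by positivity)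
    linarith
  set P := 2 * D / lam₀ ^ 2
  set Q := D * (M₂ / lam₀ ^ 3 + 1 / lam₀)
  have hP0 : 0 ≤ P := le_trans (by positivity) hP
  have hQ0 : 0 ≤ Q := le_trans (by positivity) hQ
  calc _ ≤ 2 * (δ / lam₀) * B + δ * (1 / lam₀ + M₂ / lam₀ ^ 2) * A :=
        integral_abs_transfer_sub_le hl hτ₀ hτ₁ hcov₀ hcov₁ hτ₀'
          (fun x => one_pos.trans_le (hτ₁' x)) hM₂ hδ0 hδ1 hσ₀r hσ₀l hσ₁r hσ₁l hf hfper
    _ = δ * (2 / lam₀) * B + δ * (1 / lam₀ + M₂ / lam₀ ^ 2) * A := by ring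
    _ ≤ δ * P * B + δ * Q * A := by gcongr
    _ ≤ δ * (P + Q) * B + δ * (P + Q) * A := by gcongr <;> linarith
    _ = 1 * ((P + Q) * (A + B) * δ) := by ring
    _ ≤ n * ((P + Q) * (A + B) * δ) := by gcongr
    _ = n * (P + Q) * (A + B) * δ := by ring
end
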